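/- Let μ be a complex number and n a positive odd integer. Then det_{1≤i,j≤n}( −δ_{i,j} + C(μ+i+j−2, j+1) ) = (−1)^{(n−1)/2} · 2^{(n−1)(n+5)/4} · (μ+1) · (½(μ−2))_{(n+1)/2} / (½(n+1))! · ( ∏_{i=0}^{(n−1)/2} i!² / (2i)!² ) · ( ∏_{i=1}^{⌊(n+3)/4⌋} ( (½(μ+6i−3))_{(n−4i+3)/2} )² ) · ( ∏_{i=1}^{⌊(n+1)/4⌋} ( (½(−μ−3n+6i−1))_{(n−4i+1)/2} )² ). -/

import Mathlib

/-- Generalized binomial coefficient `C(x,k) = x(x-1)⋯(x-k+1)/k!` for complex `x`. -/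
noncomputable def gbinom (x : ℂ) (k : ℕ) : ℂ :=
  (∏ i ∈ Finset.range k, (x - i)) / (k.factorial : ℂ)

/-- Pochhammer symbol `(x)_k = x(x+1)⋯(x+k-1)`. -/
noncomputable def poch (x : ℂ) (k : ℕ) : ℂ :=
  ∏ i ∈ Finset.range k, (x + i)

theorem poch_zero (z : ℂ) : poch z 0 = 1 := by simp [poch]

theorem poch_succ (z : ℂ) (n : ℕ) : poch z (n + 1) = poch z n * (z + n) := by
  simp [poch, Finset.prod_range_succ]

theorem poch_succ_left (z : ℂ) (n : ℕ) : poch z (n + 1) = z * poch (z + 1) n := by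
  simp only [poch, Finset.prod_range_succ', Nat.cast_zero, add_zero]
  rw [mul_comm]
  congr 1
  refine Finset.prod_congr rfl fun i _ => ?_
  push_cast
  ring

theorem poch_add (z : ℂ) (m n : ℕ) : poch z (m + n) = poch z m * poch (z + m) n := by
  simp only [poch, Finset.prod_range_add]
  congr 1
  refine Finset.prod_congr rfl fun i _ => ?_
  push_cast
  ring

theorem poch_ne_zero {z : ℂ} (hz : ∀ n : ℕ, z + n ≠ 0) (n : ℕ) : poch z n ≠ 0 :=
  Finset.prod_ne_zero_iff.mpr fun i _ => hz i

/-- `C(n, k + 1) = C(n, k) (n - k) / (k + 1)`, without truncated subtraction. -/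
theorem cast_choose_succ_mul (n k : ℕ) :
    (n.choose (k + 1) : ℂ) * (k + 1) = n.choose k * (n - k) := by
  rcases le_or_gt k n with h | h
  · have := Nat.choose_succ_right_eq n k
    have h2 : ((n.choose (k + 1) * (k + 1) : ℕ) : ℂ) = (n.choose k * (n - k) : ℕ) := by rw [this]
    push_cast [Nat.cast_sub h] at h2
    exact h2
  · simp [Nat.choose_eq_zero_of_lt h, Nat.choose_eq_zero_of_lt (Nat.lt_succ_of_lt h)]

theorem cast_succ_mul_choose (n k : ℕ) :
    ((n + 1 : ℂ)) * n.choose k = (n + 1).choose (k + 1) * (k + 1) := by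
  exact_mod_cast congrArg (Nat.cast : ℕ → ℂ) (Nat.add_one_mul_choose_eq n k)

/-- Chu–Vandermonde summation. -/
theorem sum_choose_mul_choose_div_poch (i j : ℕ) (z : ℂ) (hz : ∀ n : ℕ, z + n ≠ 0) :
    ∑ k ∈ Finset.range (j + 1), (i.choose k : ℂ) * j.choose k * k.factorial / poch z k
      = poch (z + i) j / poch z j := by
  induction i generalizing j z with
  | zero =>
    rw [Finset.sum_range_succ']
    simp [poch_zero, div_self (poch_ne_zero hz j)]
  | succ i ih =>
    have hz' : ∀ n : ℕ, z + 1 + n ≠ 0 := fun n => by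
      have := hz (n + 1); push_cast at this; rwa [add_assoc, add_comm (1 : ℂ)]
    have hz0 : z ≠ 0 := by simpa using hz 0
    cases j with
    | zero => simp [poch_zero]
    | succ j =>
      have h1 := ih (j + 1) z hz
      have h2 := ih j (z + 1) hz'
      rw [Finset.sum_range_succ'] at h1 ⊢
      have key : ∀ k : ℕ, ((i + 1).choose (k + 1) : ℂ) * (j + 1).choose (k + 1)
            * (k + 1).factorial / poch z (k + 1)
          = (i.choose (k + 1) : ℂ) * (j + 1).choose (k + 1) * (k + 1).factorial / poch z (k + 1)
            + (j + 1) / z * ((i.choose k : ℂ) * j.choose k * k.factorial / poch (z + 1) k) := by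
        intro k
        rw [Nat.choose_succ_succ, poch_succ_left]
        have := cast_succ_mul_choose j k
        have hp := poch_ne_zero hz' k
        push_cast [Nat.factorial_succ]
        field_simp
        linear_combination (-(i.choose k : ℂ)) * (k.factorial : ℂ) * this
      simp only [key, Finset.sum_add_distrib, ← Finset.mul_sum]
      have h3 : poch (z + (i + 1 : ℕ)) (j + 1) / poch z (j + 1) =
          poch (z + i) (j + 1) / poch z (j + 1) + (j + 1) / z * (poch (z + 1 + i) j / poch (z + 1) j) := by
        rw [poch_succ_left z, poch_succ_left (z + i), poch_succ (z + (i + 1 : ℕ))]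
        have hp := poch_ne_zero hz' j
        have : z + ((i + 1 : ℕ) : ℂ) = z + i + 1 := by push_cast; ring
        rw [this, show z + 1 + (i : ℂ) = z + i + 1 by ring]
        field_simp
        ring
      rw [h3, ← h1, h2]
      simp
      ring

/-- The Pfaff–Saalschütz summation in polynomial form. -/
theorem saalschutz (n : ℕ) (a b c : ℂ) :
    ∑ j ∈ Finset.range (n + 1), (n.choose j : ℂ) * poch a j * poch b j * poch (c + j) (n - j)
        * poch (c - a - b) (n - j)
      = poch (c - a) n * poch (c - b) n := by
  induction n with
  | zero => simp [poch_zero]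
  | succ n ih =>
    set s := c - a - b with hs
    let G : ℕ → ℂ := fun j => if j = 0 then 0 else
      -(n.choose (j - 1) : ℂ) * poch a j * poch b j * poch (c + (j - 1 : ℕ)) (n - (j - 1))
        * poch s (n - (j - 1))
    have term : ∀ j ∈ Finset.range (n + 1),
        ((n + 1).choose j : ℂ) * poch a j * poch b j * poch (c + j) (n + 1 - j) * poch s (n + 1 - j)
          - (c - a + n) * (c - b + n) * ((n.choose j : ℂ) * poch a j * poch b j
            * poch (c + j) (n - j) * poch s (n - j)) = G (j + 1) - G j := by
      intro j hj
      have hjn : j ≤ n := Nat.lt_succ_iff.mp (Finset.mem_range.mp hj)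
      obtain ⟨m, rfl⟩ := Nat.exists_eq_add_of_le hjn
      rw [show j + m + 1 - j = m + 1 by omega, show j + m - j = m by omega]
      cases j with
      | zero =>
        simp [G, poch_succ, poch_zero]
        rw [hs]; ring
      | succ i =>
        simp only [G, Nat.succ_ne_zero, if_false, Nat.add_sub_cancel]
        rw [show i + 1 + m - (i + 1) = m by omega, show i + 1 + m - i = m + 1 by omega,
          poch_succ_left (c + (i : ℕ)), poch_succ (c + ((i + 1 : ℕ) : ℂ)),
          poch_succ s, poch_succ a (i + 1), poch_succ b (i + 1), Nat.choose_succ_succ,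
          show c + (i : ℂ) + 1 = c + ((i + 1 : ℕ) : ℂ) by push_cast; ring]
        have h := cast_choose_succ_mul (i + 1 + m) i
        have hc : b = c - a - s := by rw [hs]; ring
        push_cast at h ⊢
        rw [Nat.succ_eq_add_one]
        generalize ((i + 1 + m).choose i : ℂ) = A at *
        generalize ((i + 1 + m).choose (i+1) : ℂ) = A' at *
        have hA : A * (m + 1) = A' * (i + 1) := by linear_combination -h
        linear_combination (poch a (i+1) * poch b (i+1) * poch (c + (i+1)) m * poch s m) *
          ((s + m) * hA)
    have hlast : ((n + 1).choose (n + 1) : ℂ) * poch a (n + 1) * poch b (n + 1)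
        * poch (c + (n + 1 : ℕ)) (n + 1 - (n + 1)) * poch s (n + 1 - (n + 1)) = - G (n + 1) := by
      simp [G, poch_zero]
    have tel := Finset.sum_congr rfl term
    rw [Finset.sum_sub_distrib, ← Finset.mul_sum, ih, Finset.sum_range_sub] at tel
    rw [Finset.sum_range_succ, hlast, poch_succ, poch_succ]
    have hG0 : G 0 = 0 := by simp [G]
    rw [hG0] at tel
    linear_combination tel

/-- The `j`-th finite difference of a binomial coefficient. -/
theorem sum_neg_one_pow_choose_mul_choose_add (j m a : ℕ) :
    ∑ s ∈ Finset.range (j + 1), (-1 : ℂ) ^ (j + s) * j.choose s * ((m + s).choose a : ℂ)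
      = if j ≤ a then (m.choose (a - j) : ℂ) else 0 := by
  induction j generalizing m with
  | zero => simp
  | succ j ih =>
    have h0 := ih m
    have h1 := ih (m + 1)
    have e : ∑ s ∈ Finset.range (j + 1 + 1),
          (-1 : ℂ) ^ (j + 1 + s) * (j + 1).choose s * ((m + s).choose a : ℂ)
        = ∑ s ∈ Finset.range (j + 1), (-1 : ℂ) ^ (j + s) * j.choose s * ((m + 1 + s).choose a : ℂ)
          - ∑ s ∈ Finset.range (j + 1), (-1 : ℂ) ^ (j + s) * j.choose s * ((m + s).choose a : ℂ) := by
      rw [Finset.sum_range_succ']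
      have : ∀ s, (-1 : ℂ) ^ (j + 1 + (s + 1)) * ((j + 1).choose (s + 1) : ℕ)
            * ((m + (s + 1)).choose a : ℂ)
          = (-1 : ℂ) ^ (j + s) * j.choose s * ((m + 1 + s).choose a : ℂ)
            - (-1 : ℂ) ^ (j + (s + 1)) * j.choose (s + 1) * ((m + (s + 1)).choose a : ℂ) := by
        intro s
        rw [Nat.choose_succ_succ, show m + 1 + s = m + (s + 1) by omega]
        push_cast
        ring
      simp only [this, Finset.sum_sub_distrib]
      rw [Finset.sum_range_succ' (fun s => (-1 : ℂ) ^ (j + s) * j.choose s * ((m + s).choose a : ℂ)),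
        Finset.sum_range_succ (fun s => (-1 : ℂ) ^ (j + (s + 1)) * j.choose (s + 1)
          * ((m + (s + 1)).choose a : ℂ))]
      simp
      ring
    rw [e, h0, h1]
    rcases Nat.lt_or_ge a j with h | h
    · simp [Nat.not_le.mpr h, show ¬ j + 1 ≤ a by omega]
    · obtain ⟨r, rfl⟩ := Nat.exists_eq_add_of_le h
      cases r with
      | zero => simp
      | succ r =>
        rw [if_pos h, if_pos h, if_pos (by omega), show j + (r + 1) - j = r + 1 by omega,
          show j + (r + 1) - (j + 1) = r by omega, Nat.choose_succ_succ]
        push_cast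
        ring

/-- Coefficients of the polynomial `Q_k(t) = ∑ c_j (t² - t)^j` spanning the kernel of the
leading skew-symmetric form of odd size `2 k + 1`. -/
noncomputable def kerCoeff (x : ℂ) (k : ℕ) : ℕ → ℂ
  | 0 => 1
  | j + 1 => -((k - j) * (x + 2 * j + 1) * (x + 2 * k + 2 + 2 * j))
      / ((j + 1) * (2 * k - j) * (x + 2 * k + 2 + j)) * kerCoeff x k j

theorem kerCoeff_rec {x : ℂ} (hx : ∀ n : ℕ, x + n ≠ 0) {k j : ℕ} (hj : j ≤ k) :
    (j + 1) * (2 * k - j) * (x + 2 * k + 2 + j) * kerCoeff x k (j + 1)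
      = -((k - j) * (x + 2 * j + 1) * (x + 2 * k + 2 + 2 * j)) * kerCoeff x k j := by
  rcases Nat.eq_zero_or_pos k with rfl | hk
  · obtain rfl : j = 0 := by omega
    simp
  · have h1 : (2 * k - j : ℂ) ≠ 0 := by
      rw [show (2 * k - j : ℂ) = ((2 * k - j : ℕ) : ℂ) by
        rw [Nat.cast_sub (by omega)]; push_cast; ring]
      exact_mod_cast (by omega : 2 * k - j ≠ 0)
    have h2 : (x + 2 * k + 2 + j : ℂ) ≠ 0 := by
      have := hx (2 * k + 2 + j); push_cast at this; convert this using 1; ring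
    have h3 : (j + 1 : ℂ) ≠ 0 := Nat.cast_add_one_ne_zero j
    rw [kerCoeff]
    field_simp

/-- The product of `(a - i) (x + a + 1 + i)` over `i < j`. -/
noncomputable def risFall (x a : ℂ) (j : ℕ) : ℂ :=
  ∏ i ∈ Finset.range j, (a - i) * (x + a + 1 + i)

theorem risFall_succ (x a : ℂ) (j : ℕ) :
    risFall x a (j + 1) = risFall x a j * ((a - j) * (x + a + 1 + j)) :=
  Finset.prod_range_succ _ _

theorem risFall_add_one (x a : ℂ) (j : ℕ) :
    (x + a + 1) * risFall x (a + 1) (j + 1)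
      = (a + 1) * (x + a + 1 + j) * (x + a + 2 + j) * risFall x a j := by
  induction j with
  | zero => simp [risFall]; ring
  | succ j ih =>
    rw [risFall_succ, ← mul_assoc, ih, risFall_succ x a j]
    push_cast
    ring

theorem risFall_sub_one (x a : ℂ) (j : ℕ) :
    a * risFall x (a - 1) (j + 1) = (a - j) * (a - 1 - j) * (x + a) * risFall x a j := by
  induction j with
  | zero => simp [risFall]; ring
  | succ j ih =>
    rw [risFall_succ, ← mul_assoc, ih, risFall_succ x a j]
    push_cast
    ring

theorem risFall_operator (x a κ : ℂ) (j : ℕ) :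
    (a - 2 * κ) * (a + x + 2 * κ + 2) * (a + x + 1)
          * (risFall x (a + 1) (j + 1) - risFall x a (j + 1))
        + a * (a + x + 2 * κ + 1) * (a - 2 * κ - 1)
          * (risFall x (a - 1) (j + 1) - risFall x a (j + 1))
      = (2 * a + x + 1) * ((j + 1) * (2 * j + x + 4) * risFall x a (j + 1)
        - (2 * κ - j) * (j + 1) * (x + 2 * κ + 2 + j) * (x + 2 * j + 2) * risFall x a j) := by
  have h1 := risFall_add_one x a j
  have h2 := risFall_sub_one x a j
  rw [risFall_succ x a j] at *
  linear_combination (a - 2 * κ) * (a + x + 2 * κ + 2) * h1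
    + (a + x + 2 * κ + 1) * (a - 2 * κ - 1) * h2

/-- The ascending part of the pairing of `t^a` with `(t² - t)^j` under `skewForm`. -/
noncomputable def pairOne (x a : ℂ) (j : ℕ) : ℂ := risFall x a j / poch (x + 1) (2 * j)

theorem add_one_ne {x : ℂ} (hx : ∀ n : ℕ, x + n ≠ 0) (n : ℕ) : x + 1 + n ≠ 0 := by
  have := hx (1 + n); push_cast at this; rwa [← add_assoc] at this

theorem add_two_mul_ne {x : ℂ} (hx : ∀ n : ℕ, x + n ≠ 0) (m n : ℕ) : x + 2 * m + n ≠ 0 := by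
  have := hx (2 * m + n); push_cast at this; rwa [← add_assoc] at this

theorem pairOne_succ (x a : ℂ) (j : ℕ) :
    pairOne x a (j + 1)
      = pairOne x a j * ((a - j) * (x + a + 1 + j)) / ((x + 1 + 2 * j) * (x + 2 + 2 * j)) := by
  rw [pairOne, pairOne, risFall_succ, show 2 * (j + 1) = 2 * j + 1 + 1 by ring, poch_succ,
    poch_succ]
  push_cast
  rw [show x + 1 + (2 * j + 1 : ℂ) = x + 2 + 2 * j by ring]
  simp only [div_eq_mul_inv, mul_inv]
  ring

theorem pairOne_operator {x : ℂ} (hx : ∀ n : ℕ, x + n ≠ 0) (a κ : ℂ) (j : ℕ) :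
    (a - 2 * κ) * (a + x + 2 * κ + 2) * (a + x + 1)
          * (pairOne x (a + 1) (j + 1) - pairOne x a (j + 1))
        + a * (a + x + 2 * κ + 1) * (a - 2 * κ - 1)
          * (pairOne x (a - 1) (j + 1) - pairOne x a (j + 1))
      = (2 * a + x + 1) * ((j + 1) * (2 * j + x + 4) * pairOne x a (j + 1)
        - (2 * κ - j) * (j + 1) * (x + 2 * κ + 2 + j) / (x + 2 * j + 1) * pairOne x a j) := by
  have h := risFall_operator x a κ j
  have h1 : x + 2 * j + 1 ≠ 0 := by exact_mod_cast add_two_mul_ne hx j 1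
  have h2 : x + 2 * j + 2 ≠ 0 := by exact_mod_cast add_two_mul_ne hx j 2
  have hp := poch_ne_zero (add_one_ne hx) (2 * j)
  simp only [pairOne, show 2 * (j + 1) = 2 * j + 1 + 1 by ring, poch_succ]
  push_cast
  rw [show x + 1 + (2 * j + 1 : ℂ) = x + 2 * j + 2 by ring,
    show x + 1 + 2 * (j : ℂ) = x + 2 * j + 1 by ring]
  generalize poch (x + 1) (2 * j) = p at *
  field_simp
  linear_combination h

/-- Second order recurrence in `a` for the combination of `pairOne x a j`
with weights `kerCoeff x k j`. -/
theorem sum_pairOne_operator {x : ℂ} (hx : ∀ n : ℕ, x + n ≠ 0) (a : ℂ) (k : ℕ) :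
    (a - 2 * k) * (a + x + 2 * k + 2) * (a + x + 1)
          * (∑ j ∈ Finset.range (k + 1), kerCoeff x k j * pairOne x (a + 1) j
            - ∑ j ∈ Finset.range (k + 1), kerCoeff x k j * pairOne x a j)
        + a * (a + x + 2 * k + 1) * (a - 2 * k - 1)
          * (∑ j ∈ Finset.range (k + 1), kerCoeff x k j * pairOne x (a - 1) j
            - ∑ j ∈ Finset.range (k + 1), kerCoeff x k j * pairOne x a j)
      = (2 * a + x + 1) * k * (2 * k + x + 2)
        * ∑ j ∈ Finset.range (k + 1), kerCoeff x k j * pairOne x a j := by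
  let g : ℕ → ℂ := fun j => (2 * a + x + 1) * (j - k) * (2 * j + 2 * k + x + 2)
    * kerCoeff x k j * pairOne x a j
  let T : ℕ → ℂ := fun j => kerCoeff x k j * ((a - 2 * k) * (a + x + 2 * k + 2) * (a + x + 1)
          * (pairOne x (a + 1) j - pairOne x a j)
        + a * (a + x + 2 * k + 1) * (a - 2 * k - 1)
          * (pairOne x (a - 1) j - pairOne x a j)
        - (2 * a + x + 1) * k * (2 * k + x + 2) * pairOne x a j)
  have hT : ∀ j ∈ Finset.range k, T (j + 1) = g (j + 1) - g j := by
    intro j hj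
    have hr := kerCoeff_rec hx (Finset.mem_range.mp hj).le
    have ho := pairOne_operator hx a k j
    have h1 : x + 2 * j + 1 ≠ 0 := by exact_mod_cast add_two_mul_ne hx j 1
    have hr' : (2 * k - j : ℂ) * (j + 1) * (x + 2 * k + 2 + j) / (x + 2 * j + 1)
        * kerCoeff x k (j + 1) = -((k - j) * (x + 2 * k + 2 + 2 * j)) * kerCoeff x k j := by
      field_simp
      linear_combination hr
    simp only [T, g]
    rw [ho]
    push_cast
    linear_combination (-(2 * a + x + 1) * pairOne x a j) * hr'
  have h0 : T 0 = g 0 := by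
    simp only [T, g, pairOne, risFall]
    simp [kerCoeff, poch_zero]
  have hsum : ∑ j ∈ Finset.range (k + 1), T j = 0 := by
    rw [Finset.sum_range_succ', Finset.sum_congr rfl hT, Finset.sum_range_sub, h0]
    simp [g]
  rw [← sub_eq_zero, ← hsum]
  simp only [T, mul_add, mul_sub, Finset.sum_add_distrib, Finset.sum_sub_distrib, Finset.mul_sum]
  have comm : ∀ (r : ℂ) (f : ℕ → ℂ), ∑ j ∈ Finset.range (k + 1), r * (kerCoeff x k j * f j)
      = ∑ j ∈ Finset.range (k + 1), kerCoeff x k j * (r * f j) :=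
    fun r f => Finset.sum_congr rfl fun j _ => by ring
  simp only [comm]

/-- The coefficient of `t^a` in `(t + t²)^j`. -/
def shiftChoose (a j : ℕ) : ℂ := if j ≤ a then (j.choose (a - j) : ℂ) else 0

theorem shiftChoose_zero (a : ℕ) : shiftChoose (a + 1) 0 = 0 := by simp [shiftChoose]

theorem shiftChoose_operator {x : ℂ} (hx : ∀ n : ℕ, x + n ≠ 0) {k j : ℕ} (hj : j ≤ k) (a : ℕ) :
    kerCoeff x k j * ((a + 1 - 2 * k) * (a + 1 + x + 2 * k + 2)
          * (-(a + 2) * shiftChoose (a + 2) j - (a + 1 + x + 1) * shiftChoose (a + 1) j)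
        + (a + 1 + x + 2 * k + 1) * (a + 1 - 2 * k - 1)
          * (-(x + a + 1) * shiftChoose a j - (a + 1) * shiftChoose (a + 1) j)
        - (2 * (a + 1) + x + 1) * k * (2 * k + x + 2) * shiftChoose (a + 1) j)
      = -((a + 2) * (2 * k + 1 - (j + 1 : ℕ)) * (x + 2 * k + 1 + (j + 1 : ℕ))
          * kerCoeff x k (j + 1) * shiftChoose (a + 2) (j + 1))
        + (a + 2) * (2 * k + 1 - j) * (x + 2 * k + 1 + j) * kerCoeff x k j
          * shiftChoose (a + 2) j := by
  have hr := kerCoeff_rec hx hj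
  rcases Nat.lt_or_ge a j with h | h
  · rcases Nat.lt_or_ge (a + 1) j with h' | h'
    · rcases Nat.lt_or_ge (a + 2) j with h'' | h''
      · simp [shiftChoose, show ¬ j ≤ a + 2 by omega, show ¬ j ≤ a + 1 by omega,
          show ¬ j ≤ a by omega]
      · obtain rfl : j = a + 2 := by omega
        simp [shiftChoose]
        ring
    · obtain rfl : j = a + 1 := by omega
      simp only [shiftChoose]
      simp
      push_cast at hr
      linear_combination hr
  · obtain ⟨r, rfl⟩ := Nat.exists_eq_add_of_le h
    have e1 := cast_choose_succ_mul j r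
    have e2 := cast_choose_succ_mul j (r + 1)
    have e3 := (cast_succ_mul_choose j r).symm
    have n1 : (r + 1 : ℂ) ≠ 0 := Nat.cast_add_one_ne_zero r
    have n2 : (r + 1 + 1 : ℂ) ≠ 0 := by exact_mod_cast Nat.succ_ne_zero (r + 1)
    simp only [shiftChoose, show j ≤ j + r by omega, show j ≤ j + r + 1 by omega,
      show j ≤ j + r + 2 by omega, show j + 1 ≤ j + r + 2 by omega, if_true,
      show j + r - j = r by omega, show j + r + 1 - j = r + 1 by omega,
      show j + r + 2 - j = r + 1 + 1 by omega, show j + r + 2 - (j + 1) = r + 1 by omega]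
    rw [← eq_div_iff n1] at e1 e3
    push_cast at e2 ⊢
    rw [← eq_div_iff n2, e1] at e2
    rw [e3, e2, e1]
    generalize (j.choose r : ℂ) = A at *
    field_simp
    linear_combination (A * (j + r + 2) * (r + 2)) * hr

/-- The weight `a! / (x + 1)_a`. -/
noncomputable def wt (x : ℂ) (a : ℕ) : ℂ := a.factorial / poch (x + 1) a

theorem wt_succ {x : ℂ} (hx : ∀ n : ℕ, x + n ≠ 0) (a : ℕ) :
    wt x (a + 1) * (x + a + 1) = wt x a * (a + 1) := by
  have h := add_one_ne hx a
  have hp := poch_ne_zero (add_one_ne hx) a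
  rw [wt, wt, poch_succ, Nat.factorial_succ, show x + a + 1 = x + 1 + a by ring]
  push_cast
  field_simp

theorem wt_ne_zero {x : ℂ} (hx : ∀ n : ℕ, x + n ≠ 0) (a : ℕ) : wt x a ≠ 0 :=
  div_ne_zero (Nat.cast_ne_zero.mpr (Nat.factorial_ne_zero a)) (poch_ne_zero (add_one_ne hx) a)

/-- The binomial part of the pairing of `t^a` with `(t² - t)^j` under `skewForm`. -/
noncomputable def pairTwo (x : ℂ) (a j : ℕ) : ℂ := (-1) ^ a * wt x a * shiftChoose a j

/-- Second order recurrence in `a` for the combination of `pairTwo x a j`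
with weights `kerCoeff x k j`. -/
theorem sum_pairTwo_operator {x : ℂ} (hx : ∀ n : ℕ, x + n ≠ 0) (a k : ℕ) :
    (a + 1 - 2 * k) * (a + 1 + x + 2 * k + 2) * (a + 1 + x + 1)
          * (∑ j ∈ Finset.range (k + 1), kerCoeff x k j * pairTwo x (a + 2) j
            - ∑ j ∈ Finset.range (k + 1), kerCoeff x k j * pairTwo x (a + 1) j)
        + (a + 1) * (a + 1 + x + 2 * k + 1) * (a + 1 - 2 * k - 1)
          * (∑ j ∈ Finset.range (k + 1), kerCoeff x k j * pairTwo x a j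
            - ∑ j ∈ Finset.range (k + 1), kerCoeff x k j * pairTwo x (a + 1) j)
      = (2 * (a + 1) + x + 1) * k * (2 * k + x + 2)
        * ∑ j ∈ Finset.range (k + 1), kerCoeff x k j * pairTwo x (a + 1) j := by
  let g : ℕ → ℂ := fun j => -((a + 2) * (2 * k + 1 - j) * (x + 2 * k + 1 + j)
    * kerCoeff x k j * shiftChoose (a + 2) j)
  have e1 := wt_succ hx (a + 1)
  have e0 := wt_succ hx a
  push_cast at e1
  have hT : ∀ j ∈ Finset.range (k + 1), kerCoeff x k j *
      ((a + 1 - 2 * k) * (a + 1 + x + 2 * k + 2) * (a + 1 + x + 1)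
          * (pairTwo x (a + 2) j - pairTwo x (a + 1) j)
        + (a + 1) * (a + 1 + x + 2 * k + 1) * (a + 1 - 2 * k - 1)
          * (pairTwo x a j - pairTwo x (a + 1) j)
        - (2 * (a + 1) + x + 1) * k * (2 * k + x + 2) * pairTwo x (a + 1) j)
      = (-1) ^ (a + 1) * wt x (a + 1) * (g (j + 1) - g j) := by
    intro j hj
    have ho := shiftChoose_operator hx (Nat.lt_succ_iff.mp (Finset.mem_range.mp hj)) a
    simp only [g, sub_neg_eq_add, ← ho]
    simp only [pairTwo, pow_succ]
    linear_combination (kerCoeff x k j * (a + 1 - 2 * k) * (a + 1 + x + 2 * k + 2) * (-1) ^ a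
        * shiftChoose (a + 2) j) * e1 - (kerCoeff x k j * (a + 1 + x + 2 * k + 1)
        * (a + 1 - 2 * k - 1) * (-1) ^ a * shiftChoose a j) * e0
  have hsum := Finset.sum_congr rfl hT
  have hlast : g (k + 1) = 0 := by
    have : kerCoeff x k (k + 1) = 0 := by simp [kerCoeff]
    simp [g, this]
  have hfirst : g 0 = 0 := by simp [g, shiftChoose_zero]
  rw [← Finset.mul_sum, Finset.sum_range_sub, hlast, hfirst, sub_zero, mul_zero] at hsum
  rw [← sub_eq_zero, ← hsum]
  simp only [mul_add, mul_sub, Finset.sum_add_distrib, Finset.sum_sub_distrib, Finset.mul_sum]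
  have comm : ∀ (r : ℂ) (f : ℕ → ℂ), ∑ j ∈ Finset.range (k + 1), r * (kerCoeff x k j * f j)
      = ∑ j ∈ Finset.range (k + 1), kerCoeff x k j * (r * f j) :=
    fun r f => Finset.sum_congr rfl fun j _ => by ring
  simp only [comm]

/-- The pairing of `t^a` with the kernel polynomial of index `k`. -/
noncomputable def pairSum (x : ℂ) (k a : ℕ) : ℂ :=
  ∑ j ∈ Finset.range (k + 1), kerCoeff x k j * (pairTwo x a j - pairOne x a j)

theorem pairOne_zero_left (x : ℂ) (j : ℕ) : pairOne x 0 (j + 1) = 0 := by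
  simp [pairOne, risFall, Finset.prod_range_succ']

theorem pairOne_one_left (x : ℂ) (j : ℕ) : pairOne x 1 (j + 2) = 0 := by
  simp [pairOne, risFall, Finset.prod_range_succ']

theorem pairSum_zero (x : ℂ) (k : ℕ) : pairSum x k 0 = 0 := by
  rw [pairSum, Finset.sum_range_succ']
  simp [pairTwo, shiftChoose, wt, pairOne_zero_left, poch_zero]
  simp [pairOne, risFall, poch_zero]

theorem pairSum_one {x : ℂ} (hx : ∀ n : ℕ, x + n ≠ 0) (k : ℕ) : pairSum x (k + 1) 1 = 0 := by
  rw [pairSum, Finset.sum_range_succ', Finset.sum_range_succ']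
  have h1 : x + 1 ≠ 0 := by simpa using add_one_ne hx 0
  have h2 : x + 1 + 1 ≠ 0 := by simpa using add_one_ne hx 1
  have h3 := kerCoeff_rec hx (Nat.zero_le (k + 1))
  have h4 : (k + 1 : ℂ) ≠ 0 := Nat.cast_add_one_ne_zero k
  have h5 : x + 2 * (k + 1) + 2 ≠ 0 := by exact_mod_cast add_two_mul_ne hx (k + 1) 2
  have h6 : kerCoeff x (k + 1) (0 + 1) * 2 = -(x + 1) := by
    refine mul_left_cancel₀ (mul_ne_zero h4 h5) ?_
    simp only [kerCoeff.eq_1] at h3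
    push_cast at h3
    linear_combination h3
  simp [pairTwo, shiftChoose, wt, pairOne_one_left, poch_zero, poch_succ]
  simp [pairOne, risFall, poch_zero, poch_succ, kerCoeff.eq_1]
  simp at h6
  field_simp
  linear_combination -h6

theorem pairSum_eq_zero {x : ℂ} (hx : ∀ n : ℕ, x + n ≠ 0) {k a : ℕ} (ha : a ≤ 2 * k) :
    pairSum x k a = 0 := by
  rcases Nat.eq_zero_or_pos k with rfl | hk
  · obtain rfl : a = 0 := by omega
    exact pairSum_zero x 0
  suffices h : ∀ a, a + 1 ≤ 2 * k → pairSum x k a = 0 ∧ pairSum x k (a + 1) = 0 by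
    cases a with
    | zero => exact pairSum_zero x k
    | succ a => exact (h a ha).2
  intro a
  induction a with
  | zero =>
    intro _
    obtain ⟨k, rfl⟩ := Nat.exists_eq_add_of_le' hk
    exact ⟨pairSum_zero x _, pairSum_one hx k⟩
  | succ a ih =>
    intro ha
    obtain ⟨h0, h1⟩ := ih (by omega)
    refine ⟨h1, ?_⟩
    have o1 := sum_pairOne_operator hx (a + 1) k
    have o2 := sum_pairTwo_operator hx a k
    have sp : ∀ a, pairSum x k a = ∑ j ∈ Finset.range (k + 1), kerCoeff x k j * pairTwo x a j
        - ∑ j ∈ Finset.range (k + 1), kerCoeff x k j * pairOne x a j := by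
      intro a
      simp only [pairSum, mul_sub, Finset.sum_sub_distrib]
    have t2 := sp (a + 2)
    rw [sp] at h0 h1
    push_cast at h0 h1 t2
    rw [show (a + 1 + 1 : ℂ) = a + 2 by ring, show (a + 1 - 1 : ℂ) = a by ring] at o1
    rw [show a + 1 + 1 = a + 2 from rfl]
    have n1 : (a + 1 - 2 * k : ℂ) ≠ 0 := by
      rw [sub_ne_zero]
      exact_mod_cast (by omega : a + 1 ≠ 2 * k)
    have n2 : (a + 1 + x + 2 * k + 2 : ℂ) ≠ 0 := by
      have := hx (a + 1 + 2 * k + 2); push_cast at this; convert this using 1; ring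
    have n3 : (a + 1 + x + 1 : ℂ) ≠ 0 := by
      have := hx (a + 1 + 1); push_cast at this; convert this using 1; ring
    refine mul_left_cancel₀ (mul_ne_zero (mul_ne_zero n1 n2) n3) ?_
    rw [t2]
    linear_combination o2 - o1 + ((2 * (a + 1) + x + 1) * k * (2 * k + x + 2)
      + (a + 1 - 2 * k) * (a + 1 + x + 2 * k + 2) * (a + 1 + x + 1)
      + (a + 1) * (a + 1 + x + 2 * k + 1) * (a + 1 - 2 * k - 1)) * h1
      - (a + 1) * (a + 1 + x + 2 * k + 1) * (a + 1 - 2 * k - 1) * h0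

theorem sum_mul_shiftChoose (F : ℕ → ℂ) {j N : ℕ} (hN : 2 * j < N) :
    ∑ b ∈ Finset.range N, F b * ((-1) ^ b * shiftChoose b j)
      = ∑ s ∈ Finset.range (j + 1), (-1) ^ (j + s) * (j.choose s : ℂ) * F (j + s) := by
  obtain ⟨r, rfl⟩ : ∃ r, N = j + (j + 1 + r) := ⟨N - (2 * j + 1), by omega⟩
  rw [Finset.sum_range_add, Finset.sum_range_add, Finset.sum_eq_zero, zero_add,
    Finset.sum_eq_zero (s := Finset.range r), add_zero]
  · refine Finset.sum_congr rfl fun s _ => ?_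
    simp [shiftChoose]
    ring
  · intro s _
    simp [shiftChoose, Nat.choose_eq_zero_of_lt (show j < j + 1 + s by omega)]
  · intro b hb
    simp [shiftChoose, Nat.not_le.mpr (Finset.mem_range.mp hb)]

/-- The value at `(t^a, t^b)` of a skew-symmetric form on polynomials. -/
noncomputable def skewForm (x : ℂ) (a b : ℕ) : ℂ :=
  (-1) ^ a * b.choose a * wt x a - (-1) ^ b * a.choose b * wt x b

theorem skewForm_swap (x : ℂ) (a b : ℕ) : skewForm x a b = -skewForm x b a := by
  rw [skewForm, skewForm, neg_sub]

theorem sum_choose_wt {x : ℂ} (hx : ∀ n : ℕ, x + n ≠ 0) (a j : ℕ) :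
    ∑ s ∈ Finset.range (j + 1), (j.choose s : ℂ) * (a.choose (j + s) * wt x (j + s))
      = pairOne x a j := by
  rcases Nat.lt_or_ge a j with h | h
  · rw [Finset.sum_eq_zero, pairOne, risFall, Finset.prod_eq_zero (Finset.mem_range.mpr h),
      zero_div]
    · simp
    · intro s _
      simp [Nat.choose_eq_zero_of_lt (show a < j + s by omega)]
  · obtain ⟨i, rfl⟩ := Nat.exists_eq_add_of_le' h
    have hz : ∀ n : ℕ, x + 1 + j + n ≠ 0 := fun n => by
      have := hx (1 + j + n); push_cast at this; convert this using 1; ring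
    have chu := sum_choose_mul_choose_div_poch i j (x + 1 + j) hz
    have hd : risFall x (i + j : ℕ) j
        = (i + j).factorial / i.factorial * poch (x + 1 + j + i) j := by
      have h1 : ∀ j : ℕ, ((i + j).factorial : ℂ) / i.factorial
          = ∏ t ∈ Finset.range j, ((i : ℂ) + 1 + t) := by
        intro j
        induction j with
        | zero => simp [Nat.factorial_ne_zero]
        | succ j ih =>
          rw [Finset.prod_range_succ, ← ih, ← add_assoc, Nat.factorial_succ]
          push_cast
          ring
      rw [h1, risFall, Finset.prod_mul_distrib, ← Finset.prod_range_reflect, poch]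
      congr 1
      · refine Finset.prod_congr rfl fun t ht => ?_
        have ht := Finset.mem_range.mp ht
        rw [show j - 1 - t = j - (1 + t) by omega, Nat.cast_sub (by omega)]
        push_cast
        ring
      · refine Finset.prod_congr rfl fun t _ => ?_
        push_cast
        ring
    have hc : ∀ s, ((i + j).choose (j + s) : ℂ) * (j + s).factorial
        = (i + j).factorial / i.factorial * (i.choose s * s.factorial) := by
      intro s
      have hi : (i.factorial : ℂ) ≠ 0 := Nat.cast_ne_zero.mpr (Nat.factorial_ne_zero i)
      rcases Nat.lt_or_ge i s with hs | hs
      · simp [Nat.choose_eq_zero_of_lt hs, Nat.choose_eq_zero_of_lt (show i + j < j + s by omega)]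
      · have h1 := Nat.choose_mul_factorial_mul_factorial hs
        have h2 := Nat.choose_mul_factorial_mul_factorial (show j + s ≤ i + j by omega)
        rw [show i + j - (j + s) = i - s by omega] at h2
        have h1 := congrArg (Nat.cast : ℕ → ℂ) h1
        have h2 := congrArg (Nat.cast : ℕ → ℂ) h2
        have h3 : ((i - s).factorial : ℂ) ≠ 0 := Nat.cast_ne_zero.mpr (Nat.factorial_ne_zero _)
        push_cast at h1 h2
        refine mul_right_cancel₀ (mul_ne_zero h3 hi) ?_
        field_simp
        rw [← h1, ← h2]
        ring
    have hp := poch_ne_zero (add_one_ne hx) j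
    have hp' := poch_ne_zero hz j
    rw [pairOne, hd, two_mul, poch_add]
    trans ((i + j).factorial / i.factorial / poch (x + 1) j : ℂ)
      * (poch (x + 1 + j + i) j / poch (x + 1 + j) j)
    · rw [← chu, Finset.mul_sum]
      refine Finset.sum_congr rfl fun s _ => ?_
      rw [wt, poch_add, ← mul_div_assoc, hc]
      have := poch_ne_zero hz s
      field_simp
    · field_simp

theorem sum_skewForm_mul_shiftChoose {x : ℂ} (hx : ∀ n : ℕ, x + n ≠ 0) (a : ℕ) {j N : ℕ}
    (hN : 2 * j < N) :
    ∑ b ∈ Finset.range N, skewForm x a b * ((-1) ^ b * shiftChoose b j)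
      = pairTwo x a j - pairOne x a j := by
  rw [sum_mul_shiftChoose _ hN, ← sum_choose_wt hx, pairTwo]
  have h := sum_neg_one_pow_choose_mul_choose_add j j a
  rw [shiftChoose, ← h, Finset.mul_sum, ← Finset.sum_sub_distrib]
  refine Finset.sum_congr rfl fun s _ => ?_
  rw [skewForm]
  have e : (-1 : ℂ) ^ (j + s) * (-1) ^ (j + s) = 1 := by
    rw [← mul_pow]; simp
  linear_combination (-(j.choose s : ℂ) * a.choose (j + s) * wt x (j + s)) * e

/-- The coefficient vector of `Q_k(t) = ∑ c_j (t² - t)^j`. -/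
noncomputable def kerVec (x : ℂ) (k b : ℕ) : ℂ :=
  ∑ j ∈ Finset.range (k + 1), kerCoeff x k j * ((-1) ^ b * shiftChoose b j)

theorem sum_mul_kerVec (F : ℕ → ℂ) (x : ℂ) (k N : ℕ) :
    ∑ b ∈ Finset.range N, F b * kerVec x k b = ∑ j ∈ Finset.range (k + 1), kerCoeff x k j
      * ∑ b ∈ Finset.range N, F b * ((-1) ^ b * shiftChoose b j) := by
  simp only [kerVec, Finset.mul_sum]
  rw [Finset.sum_comm]
  exact Finset.sum_congr rfl fun _ _ => Finset.sum_congr rfl fun _ _ => by ring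

theorem sum_skewForm_mul_kerVec {x : ℂ} (hx : ∀ n : ℕ, x + n ≠ 0) (a : ℕ) {k N : ℕ}
    (hN : 2 * k < N) :
    ∑ b ∈ Finset.range N, skewForm x a b * kerVec x k b = pairSum x k a := by
  rw [sum_mul_kerVec, pairSum]
  refine Finset.sum_congr rfl fun j hj => ?_
  rw [sum_skewForm_mul_shiftChoose hx]
  have := Finset.mem_range.mp hj
  omega

theorem sum_choose_mul_kerVec (x : ℂ) (i : ℕ) {k N : ℕ} (hN : 2 * k < N) :
    ∑ b ∈ Finset.range N, (-1) ^ i * (b.choose i : ℂ) * kerVec x k b = kerVec x k i := by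
  rw [sum_mul_kerVec, kerVec]
  refine Finset.sum_congr rfl fun j hj => ?_
  have := Finset.mem_range.mp hj
  rw [sum_mul_shiftChoose _ (by omega), shiftChoose,
    ← sum_neg_one_pow_choose_mul_choose_add j j i, Finset.mul_sum, Finset.mul_sum, Finset.mul_sum]
  exact Finset.sum_congr rfl fun _ _ => by ring

theorem kerVec_zero (x : ℂ) (k : ℕ) : kerVec x k 0 = 1 := by
  rw [kerVec, Finset.sum_range_succ']
  simp [shiftChoose, kerCoeff]

theorem kerVec_one {x : ℂ} (hx : ∀ n : ℕ, x + n ≠ 0) (k : ℕ) :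
    kerVec x (k + 1) 1 = (x + 1) / 2 := by
  rw [kerVec, Finset.sum_range_succ', Finset.sum_range_succ']
  have h5 : x + 2 * (k + 1) + 2 ≠ 0 := by exact_mod_cast add_two_mul_ne hx (k + 1) 2
  have h4 : (k + 1 : ℂ) ≠ 0 := Nat.cast_add_one_ne_zero k
  simp only [shiftChoose, kerCoeff]
  simp
  rw [show x + 2 * (k + 1) + 2 = x + 2 * (k + 1 : ℂ) + 2 from rfl]
  generalize x + 2 * (k + 1) + 2 = y at *
  field_simp

theorem kerVec_two_mul (x : ℂ) (k : ℕ) : kerVec x k (2 * k) = kerCoeff x k k := by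
  rw [kerVec, Finset.sum_range_succ, Finset.sum_eq_zero]
  · simp [shiftChoose, show k ≤ 2 * k by omega, show 2 * k - k = k by omega]
  · intro j hj
    have := Finset.mem_range.mp hj
    simp [shiftChoose, Nat.choose_eq_zero_of_lt (show j < 2 * k - j by omega)]

theorem kerVec_eq_zero (x : ℂ) {k b : ℕ} (hb : 2 * k < b) : kerVec x k b = 0 := by
  refine Finset.sum_eq_zero fun j hj => ?_
  have := Finset.mem_range.mp hj
  simp [shiftChoose, Nat.choose_eq_zero_of_lt (show j < b - j by omega)]

theorem kerCoeff_self {x : ℂ} (hx : ∀ n : ℕ, x + n ≠ 0) (k : ℕ) :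
    kerCoeff x k k = (-1) ^ k * k.factorial / (2 * k).factorial
      * ∏ i ∈ Finset.range k, ((x + 2 * i + 1) * (x + 2 * k + 2 + 2 * i) / (x + 2 * k + 2 + i)) := by
  have h : ∀ j ≤ k, kerCoeff x k j = (-1) ^ j * k.choose j * (2 * k - j).factorial / (2 * k).factorial
      * ∏ i ∈ Finset.range j, ((x + 2 * i + 1) * (x + 2 * k + 2 + 2 * i) / (x + 2 * k + 2 + i)) := by
    intro j
    induction j with
    | zero => simp [kerCoeff, Nat.factorial_ne_zero]
    | succ j ih =>
      intro hj
      rw [kerCoeff, ih (by omega), Finset.prod_range_succ]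
      have hc := cast_choose_succ_mul k j
      have h3 : (j + 1 : ℂ) ≠ 0 := Nat.cast_add_one_ne_zero j
      rw [← eq_div_iff h3] at hc
      obtain ⟨r, hr⟩ : ∃ r, 2 * k - j = r + 1 := ⟨2 * k - j - 1, by omega⟩
      have hr' : (2 * k - j : ℂ) = r + 1 := by
        rw [sub_eq_iff_eq_add]
        exact_mod_cast (by omega : 2 * k = r + 1 + j)
      have h1 : (r + 1 : ℂ) ≠ 0 := Nat.cast_add_one_ne_zero r
      have h2 : ((2 * k).factorial : ℂ) ≠ 0 := Nat.cast_ne_zero.mpr (Nat.factorial_ne_zero _)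
      have h4 : (x + 2 * k + 2 + j : ℂ) ≠ 0 := by
        have := hx (2 * k + 2 + j); push_cast at this; convert this using 1; ring
      rw [hr, show 2 * k - (j + 1) = r by omega, hr', hc, Nat.factorial_succ]
      push_cast
      generalize (∏ i ∈ Finset.range j, ((x + 2 * i + 1) * (x + 2 * k + 2 + 2 * i)
        / (x + 2 * k + 2 + i)) : ℂ) = R
      field_simp
      ring
  rw [h k le_rfl, Nat.choose_self, show 2 * k - k = k by omega]
  simp

theorem kerCoeff_self_ne_zero {x : ℂ} (hx : ∀ n : ℕ, x + n ≠ 0) (k : ℕ) : kerCoeff x k k ≠ 0 := by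
  rw [kerCoeff_self hx]
  refine mul_ne_zero (div_ne_zero (mul_ne_zero (by simp) ?_) ?_) (Finset.prod_ne_zero_iff.mpr ?_)
  · exact Nat.cast_ne_zero.mpr (Nat.factorial_ne_zero _)
  · exact Nat.cast_ne_zero.mpr (Nat.factorial_ne_zero _)
  · intro i _
    have h1 := hx (2 * i + 1)
    have h2 := hx (2 * k + 2 + 2 * i)
    have h3 := hx (2 * k + 2 + i)
    push_cast at h1 h2 h3
    simp only [← add_assoc] at h1 h2 h3
    exact div_ne_zero (mul_ne_zero h1 h2) h3

theorem poch_reflect (z : ℂ) (n : ℕ) : poch (1 - z - n) n = (-1) ^ n * poch z n := by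
  have h : ((-1 : ℂ)) ^ n = ∏ _i ∈ Finset.range n, (-1 : ℂ) := by simp
  rw [poch, poch, ← Finset.prod_range_reflect, h, ← Finset.prod_mul_distrib]
  refine Finset.prod_congr rfl fun i hi => ?_
  have := Finset.mem_range.mp hi
  rw [show n - 1 - i = n - (i + 1) by omega, Nat.cast_sub (by omega)]
  push_cast
  ring

theorem poch_natCast_add_one (m n : ℕ) : poch (m + 1) n = (m + n).factorial / m.factorial := by
  induction n with
  | zero => simp [poch_zero, Nat.factorial_ne_zero]
  | succ n ih =>
    rw [poch_succ, ih, ← add_assoc, Nat.factorial_succ]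
    push_cast
    ring

/-- The pairing of `t^(2 * k + 1)` with `Q_k`, evaluated by the Pfaff–Saalschütz theorem. -/
theorem pairSum_two_mul_add_one {x : ℂ} (hx : ∀ n : ℕ, x + n ≠ 0) (k : ℕ) :
    pairSum x k (2 * k + 1) = (-1) ^ (k + 1) * k.factorial ^ 2 / (2 * k).factorial
      * ∏ i ∈ Finset.range k, ((x + 4 * k + 4 + 2 * i) / (x + 2 + 2 * i)) := by
  set a : ℂ := -(2 * k + 1) with ha
  set b : ℂ := x / 2 + k + 1 with hb
  set c : ℂ := -(2 * k) with hc
  let T : ℕ → ℂ := fun j => (k.choose j : ℂ) * poch a j * poch b j * poch (c + j) (k - j)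
    * poch (c - a - b) (k - j)
  have hS := saalschutz k a b c
  have n1 : ∀ i ∈ Finset.range k, (x + 2 + 2 * i : ℂ) ≠ 0 := fun i _ => by
    have := hx (2 + 2 * i); push_cast at this; rwa [← add_assoc] at this
  have hterm : ∀ j ≤ k, kerCoeff x k j * pairOne x (2 * k + 1 : ℕ) j * T 0 = T j := by
    intro j
    induction j with
    | zero => simp [kerCoeff, pairOne, risFall, poch_zero]
    | succ j ih =>
      intro hj
      have ih := ih (by omega)
      have hr := kerCoeff_rec hx (show j ≤ k by omega)
      have m1 : (2 * k - j : ℂ) ≠ 0 := by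
        rw [sub_ne_zero]; exact_mod_cast (by omega : 2 * k ≠ j)
      have m2 : (x + 2 * k + 2 + j : ℂ) ≠ 0 := by
        have := hx (2 * k + 2 + j); push_cast at this; convert this using 1; ring
      have m3 : (j + 1 : ℂ) ≠ 0 := Nat.cast_add_one_ne_zero j
      have m4 : (x + 2 + 2 * j : ℂ) ≠ 0 := n1 j (Finset.mem_range.mpr (by omega))
      have m5 : (x + 1 + 2 * j : ℂ) ≠ 0 := by
        have := hx (1 + 2 * j); push_cast at this; rwa [← add_assoc] at this
      have hT : T (j + 1) * ((j + 1) * (2 * k - j) * (x + 2 + 2 * j))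
          = -(T j * ((k - j) * (2 * k + 1 - j) * (x + 2 * k + 2 + 2 * j))) := by
        obtain ⟨r, hr⟩ : ∃ r, k = j + 1 + r := ⟨k - (j + 1), by omega⟩
        have hr' : (r : ℂ) = k - j - 1 := by rw [hr]; push_cast; ring
        have hch := cast_choose_succ_mul k j
        simp only [T]
        rw [show k - (j + 1) = r by omega, show k - j = r + 1 by omega, poch_succ_left (c + j),
          poch_succ (c - a - b), poch_succ a, poch_succ b,
          show c + ((j + 1 : ℕ) : ℂ) = c + j + 1 by push_cast; ring, hr']
        generalize poch a j = p1 at *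
        generalize poch b j = p2 at *
        generalize poch (c + j + 1) r = p3 at *
        generalize poch (c - a - b) r = p4 at *
        rw [ha, hb, hc]
        linear_combination (-(2 * k + 1) + j : ℂ) * p1 * p2 * (x / 2 + k + 1 + j) * p3 * p4
          * (2 * k - j) * (x + 2 + 2 * j) * hch
      refine mul_right_cancel₀ (mul_ne_zero (mul_ne_zero m3 m1) m4) ?_
      rw [hT, ← ih, pairOne_succ]
      push_cast
      field_simp
      linear_combination (pairOne x (2 * k + 1) j * T 0 * (2 * k + 1 - j)) * hr
  have hk0 : (k.factorial : ℂ) ≠ 0 := Nat.cast_ne_zero.mpr (Nat.factorial_ne_zero _)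
  have hk1 : ((2 * k).factorial : ℂ) ≠ 0 := Nat.cast_ne_zero.mpr (Nat.factorial_ne_zero _)
  have hq : poch (x / 2 + 1) k ≠ 0 := poch_ne_zero (fun n => by
    have := hx (2 + 2 * n)
    push_cast at this
    intro h
    exact this (by linear_combination 2 * h)) k
  have hT0' : T 0 = (2 * k).factorial / k.factorial * poch (x / 2 + 1) k := by
    have e1 := poch_reflect (k + 1) k
    have e2 := poch_reflect (x / 2 + 1) k
    rw [poch_natCast_add_one, ← two_mul, show 1 - (k + 1) - k = c by rw [hc]; ring] at e1
    rw [show 1 - (x / 2 + 1) - k = c - a - b by rw [hc, ha, hb]; ring] at e2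
    simp only [T]
    simp only [Nat.choose_zero_right, Nat.cast_one, poch_zero, Nat.cast_zero, add_zero,
      Nat.sub_zero, e1, e2]
    have e : (-1 : ℂ) ^ k * (-1) ^ k = 1 := by rw [← mul_pow]; simp
    linear_combination ((2 * k).factorial / k.factorial * poch (x / 2 + 1) k : ℂ) * e
  have hT0 : T 0 ≠ 0 := by
    rw [hT0']
    exact mul_ne_zero (div_ne_zero hk1 hk0) hq
  have hsum : pairSum x k (2 * k + 1) * T 0 = -(poch (c - a) k * poch (c - b) k) := by
    rw [← hS, pairSum, Finset.sum_mul, ← Finset.sum_neg_distrib]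
    refine Finset.sum_congr rfl fun j hj => ?_
    have hj := Nat.lt_succ_iff.mp (Finset.mem_range.mp hj)
    have ht := hterm j hj
    simp only [T] at ht ⊢
    rw [← ht, pairTwo, shiftChoose, Nat.choose_eq_zero_of_lt (by omega)]
    simp
  refine mul_right_cancel₀ hT0 ?_
  rw [hsum]
  have hprod : ∏ i ∈ Finset.range k, ((x + 4 * k + 4 + 2 * i) / (x + 2 + 2 * i))
      = poch (x / 2 + 2 * k + 2) k / poch (x / 2 + 1) k := by
    rw [poch, poch, ← Finset.prod_div_distrib]
    refine Finset.prod_congr rfl fun i hi => ?_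
    rw [← mul_div_mul_left (x / 2 + 2 * k + 2 + i) (x / 2 + 1 + i) two_ne_zero]
    congr 1 <;> ring
  have e3 := poch_reflect (x / 2 + 2 * k + 2) k
  rw [show 1 - (x / 2 + 2 * k + 2) - k = c - b by rw [hc, hb]; ring] at e3
  have e4 := poch_natCast_add_one 0 k
  simp only [Nat.cast_zero, zero_add, Nat.factorial_zero, Nat.cast_one, div_one] at e4
  rw [show c - a = 1 by rw [hc, ha]; ring, e3, e4, hprod, hT0', pow_succ]
  generalize poch (x / 2 + 1) k = p at *
  field_simp

theorem pairSum_two_mul_add_one_ne_zero {x : ℂ} (hx : ∀ n : ℕ, x + n ≠ 0) (k : ℕ) :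
    pairSum x k (2 * k + 1) ≠ 0 := by
  rw [pairSum_two_mul_add_one hx]
  refine mul_ne_zero (div_ne_zero (mul_ne_zero (by simp) (pow_ne_zero 2 ?_)) ?_)
    (Finset.prod_ne_zero_iff.mpr ?_)
  · exact Nat.cast_ne_zero.mpr (Nat.factorial_ne_zero _)
  · exact Nat.cast_ne_zero.mpr (Nat.factorial_ne_zero _)
  · intro i _
    have h1 := hx (4 * k + 4 + 2 * i)
    have h2 := hx (2 + 2 * i)
    push_cast at h1 h2
    simp only [← add_assoc] at h1 h2
    exact div_ne_zero h1 h2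

/-- If `f` is skew-symmetric and `q` pairs to zero with all but the last basis vector, the
determinant of size `n + 2` reduces to the one of size `n`. -/
theorem det_skew_succ_succ (n : ℕ) (f : ℕ → ℕ → ℂ) (hf : ∀ a b, f a b = -f b a) (q : ℕ → ℂ) (h : ℂ)
    (hq : ∀ a ≤ n + 1, ∑ b ∈ Finset.range (n + 2), f a b * q b = if a = n + 1 then h else 0)
    (hq0 : q (n + 1) = 0) :
    (Matrix.of fun i j : Fin (n + 2) => f i j).det * q n ^ 2
      = h ^ 2 * (Matrix.of fun i j : Fin n => f i j).det := by
  set M : Matrix (Fin (n + 2)) (Fin (n + 2)) ℂ := Matrix.of fun i j => f i j with hM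
  set p : Fin (n + 1) := Fin.last n
  set M1 : Matrix (Fin (n + 1)) (Fin (n + 1)) ℂ :=
    M.submatrix (Fin.last (n + 1)).succAbove p.castSucc.succAbove with hM1
  have h1 : M.mulVec (fun b => q b) = Pi.single (Fin.last (n + 1)) h := by
    ext a
    have := hq a (by omega)
    rw [Finset.sum_range] at this
    simp only [Matrix.mulVec, dotProduct, hM, Matrix.of_apply, this, Pi.single_apply,
      Fin.ext_iff, Fin.val_last]
  have h2 : M.det * q n = -h * M1.det := by
    have := congrArg (fun v => M.adjugate.mulVec v p.castSucc) h1
    simp only [Matrix.mulVec_mulVec, Matrix.adjugate_mul, Matrix.smul_mulVec, Matrix.one_mulVec,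
      Matrix.mulVec_single] at this
    simp [p, Matrix.col_apply, Matrix.adjugate_fin_succ_eq_det_submatrix] at this
    rw [this, hM1]
    simp [p]
    ring
  have hval : ∀ j : Fin (n + 1), ((p.castSucc.succAbove j : Fin (n + 2)) : ℕ)
      = if j = p then n + 1 else j := by
    intro j
    simp only [Fin.succAbove, p, Fin.lt_def, Fin.ext_iff, Fin.val_last, Fin.val_castSucc]
    split_ifs <;> simp <;> omega
  have h3 : Matrix.vecMul (fun a : Fin (n + 1) => q a) M1 = Pi.single p (-h) := by
    ext j
    set c := p.castSucc.succAbove j with hc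
    have := hq c (by omega)
    rw [Finset.sum_range, Fin.sum_univ_castSucc] at this
    simp only [Fin.val_last, hq0, mul_zero, add_zero, Fin.val_castSucc] at this
    simp only [Matrix.vecMul, dotProduct, hM1, hM, Matrix.submatrix_apply, Matrix.of_apply,
      Fin.succAbove_last, Fin.val_castSucc, ← hc]
    rw [Finset.sum_congr rfl (fun a _ => by rw [hf a c, mul_neg, mul_comm]),
      Finset.sum_neg_distrib, this, hc, hval]
    by_cases hj : j = p
    · simp [hj]
    · have : (j : ℕ) ≠ n + 1 := by omega
      simp [hj, this]
  have h4 : M1.det * q n = -h * (Matrix.of fun i j : Fin n => f i j).det := by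
    have := congrArg (fun v => Matrix.vecMul v M1.adjugate p) h3
    simp only [Matrix.vecMul_vecMul, Matrix.mul_adjugate, Matrix.vecMul_smul, Matrix.vecMul_one,
      Matrix.single_vecMul] at this
    simp [p, Matrix.adjugate_fin_succ_eq_det_submatrix, ← two_mul, pow_mul] at this
    have hsub : M1.submatrix Fin.castSucc Fin.castSucc = Matrix.of fun i j : Fin n => f i j := by
      ext i j
      simp only [hM1, hM, Matrix.submatrix_apply, Matrix.of_apply, hval, Fin.succAbove_last,
        Fin.val_castSucc, p, (Fin.castSucc_lt_last j).ne, if_false]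
    rw [this, hsub, neg_mul]
  linear_combination q n * h2 - h * h4

theorem det_skewForm {x : ℂ} (hx : ∀ n : ℕ, x + n ≠ 0) (K : ℕ) :
    (Matrix.of fun i j : Fin (2 * K) => skewForm x i j).det
      = ∏ k ∈ Finset.range K, (pairSum x k (2 * k + 1) / kerCoeff x k k) ^ 2 := by
  induction K with
  | zero => simp
  | succ K ih =>
    have h := det_skew_succ_succ (2 * K) (skewForm x) (skewForm_swap x) (kerVec x K)
      (pairSum x K (2 * K + 1)) (fun a ha => by
        rw [sum_skewForm_mul_kerVec hx a (by omega)]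
        split_ifs with h
        · rw [h]
        · exact pairSum_eq_zero hx (by omega)) (kerVec_eq_zero x (by omega))
    have hL := kerCoeff_self_ne_zero hx K
    rw [kerVec_two_mul] at h
    rw [Finset.prod_range_succ, ← ih, div_pow]
    field_simp
    rw [mul_comm] at h
    rw [mul_add, mul_one] at *
    linear_combination h

/-- Two entries of a row of the adjugate are proportional to the corresponding entries
of a kernel vector. -/
theorem adjugate_mul_of_mulVec_eq_zero {ι : Type*} [Fintype ι] [DecidableEq ι]
    (A : Matrix ι ι ℂ) (q : ι → ℂ) (hq : A.mulVec q = 0) (hq0 : q ≠ 0) (i j l : ι) :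
    q l * A.adjugate j i = q j * A.adjugate l i := by
  have h : (A.updateRow i (q l • Pi.single j 1 + (-q j) • Pi.single l 1)).det = 0 := by
    rw [← Matrix.exists_mulVec_eq_zero_iff]
    refine ⟨q, hq0, ?_⟩
    ext a
    by_cases ha : a = i
    · subst ha
      rw [Matrix.mulVec, Matrix.updateRow_self, add_dotProduct, smul_dotProduct, smul_dotProduct,
        single_dotProduct, single_dotProduct]
      simp only [smul_eq_mul, Pi.zero_apply]
      ring
    · have := congrFun hq a
      simpa [Matrix.mulVec, Matrix.updateRow_ne ha] using this
  rw [Matrix.det_updateRow_add, Matrix.det_updateRow_smul, Matrix.det_updateRow_smul,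
    ← Matrix.adjugate_apply, ← Matrix.adjugate_apply] at h
  linear_combination h

theorem adjugate_mul_of_vecMul_eq_zero {ι : Type*} [Fintype ι] [DecidableEq ι]
    (A : Matrix ι ι ℂ) (q : ι → ℂ) (hq : Matrix.vecMul q A = 0) (hq0 : q ≠ 0) (i j l : ι) :
    q l * A.adjugate i j = q j * A.adjugate i l := by
  have := adjugate_mul_of_mulVec_eq_zero A.transpose q (by rwa [Matrix.mulVec_transpose]) hq0 i j l
  simpa [← Matrix.adjugate_transpose] using this

/-- Signed Pascal triangle. -/
def signedChoose (i k : ℕ) : ℂ := (-1) ^ k * i.choose k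

theorem sum_signedChoose_mul {N i : ℕ} (hi : i < N) (j : ℕ) :
    ∑ k ∈ Finset.range N, signedChoose i k * signedChoose k j = if i = j then 1 else 0 := by
  have h := sum_neg_one_pow_choose_mul_choose_add i 0 j
  rw [← Finset.sum_range_add_sum_Ico _ hi, Finset.sum_eq_zero (s := Finset.Ico _ _), add_zero]
  · simp only [zero_add] at h
    have e : (-1 : ℂ) ^ i * (-1) ^ i = 1 := by rw [← mul_pow]; simp
    trans (-1) ^ i * (-1) ^ j * ∑ s ∈ Finset.range (i + 1), (-1 : ℂ) ^ (i + s) * i.choose s * s.choose j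
    · rw [Finset.mul_sum]
      refine Finset.sum_congr rfl fun s _ => ?_
      rw [signedChoose, signedChoose, pow_add]
      linear_combination (-((-1) ^ j * (-1) ^ s * i.choose s * s.choose j) : ℂ) * e
    · rw [h]
      rcases lt_trichotomy i j with hij | rfl | hij
      · simp [hij.le, hij.ne, Nat.choose_eq_zero_of_lt (show 0 < j - i by omega)]
      · simp [e]
      · simp [hij.ne', Nat.not_le.mpr hij]
  · intro k hk
    have := Finset.mem_Ico.mp hk
    simp [signedChoose, Nat.choose_eq_zero_of_lt (show i < k by omega)]

/-- The entries of the product of the signed Pascal matrix with the matrix of `skewForm`. -/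
noncomputable def prodEntry (x : ℂ) (i j : ℕ) : ℂ :=
  ∑ k ∈ Finset.range (i + 1), signedChoose i k * skewForm x k j

theorem prodEntry_eq_sum (x : ℂ) {i N : ℕ} (hi : i < N) (j : ℕ) :
    prodEntry x i j = ∑ k ∈ Finset.range N, signedChoose i k * skewForm x k j := by
  rw [prodEntry, ← Finset.sum_range_add_sum_Ico _ hi, Finset.sum_eq_zero (s := Finset.Ico _ _),
    add_zero]
  intro k hk
  have := Finset.mem_Ico.mp hk
  simp [signedChoose, Nat.choose_eq_zero_of_lt (show i < k by omega)]

theorem gbinom_add_eq (z : ℂ) (j : ℕ) : gbinom (z + j) j = poch (z + 1) j / j.factorial := by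
  rw [gbinom, poch, ← Finset.prod_range_reflect]
  congr 1
  refine Finset.prod_congr rfl fun i hi => ?_
  have := Finset.mem_range.mp hi
  rw [show j - 1 - i = j - (i + 1) by omega, Nat.cast_sub (by omega)]
  push_cast
  ring

theorem prodEntry_eq {x : ℂ} (hx : ∀ n : ℕ, x + n ≠ 0) (i j : ℕ) :
    prodEntry x i j = wt x j * ((if i = j then -1 else 0) + gbinom (x + i + j) j) := by
  rw [prodEntry_eq_sum x (show i < i + j + 1 by omega)]
  have h1 := sum_signedChoose_mul (show i < i + j + 1 by omega) j
  have h2 := sum_choose_mul_choose_div_poch i j (x + 1) (add_one_ne hx)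
  have h3 : ∑ k ∈ Finset.range (i + j + 1), (i.choose k : ℂ) * j.choose k * wt x k
      = poch (x + 1 + i) j / poch (x + 1) j := by
    rw [← h2, ← Finset.sum_range_add_sum_Ico _ (show j < i + j + 1 by omega),
      Finset.sum_eq_zero (s := Finset.Ico _ _), add_zero]
    · exact Finset.sum_congr rfl fun k _ => by rw [wt, mul_div_assoc]
    · intro k hk
      have := Finset.mem_Ico.mp hk
      simp [Nat.choose_eq_zero_of_lt (show j < k by omega)]
  have h4 : ∀ k, signedChoose i k * skewForm x k j = (i.choose k : ℂ) * j.choose k * wt x k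
      - wt x j * (signedChoose i k * signedChoose k j) := by
    intro k
    have e : (-1 : ℂ) ^ k * (-1) ^ k = 1 := by rw [← mul_pow]; simp
    simp only [signedChoose, skewForm]
    linear_combination (i.choose k * j.choose k * wt x k : ℂ) * e
  simp only [h4, Finset.sum_sub_distrib, ← Finset.mul_sum, h1, h3]
  rw [gbinom_add_eq, wt, show x + i + 1 = x + 1 + i by ring]
  have : (j.factorial : ℂ) ≠ 0 := Nat.cast_ne_zero.mpr (Nat.factorial_ne_zero _)
  have hp := poch_ne_zero (add_one_ne hx) j
  split_ifs <;> field_simp <;> ring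

theorem sum_prodEntry_mul_kerVec {x : ℂ} (hx : ∀ n : ℕ, x + n ≠ 0) {K a : ℕ} (ha : a ≤ 2 * K) :
    ∑ b ∈ Finset.range (2 * K + 1), prodEntry x a b * kerVec x K b = 0 := by
  simp only [prodEntry, Finset.sum_mul]
  rw [Finset.sum_comm]
  refine Finset.sum_eq_zero fun k hk => ?_
  have hk := Finset.mem_range.mp hk
  simp only [mul_assoc, ← Finset.mul_sum]
  rw [sum_skewForm_mul_kerVec hx k (by omega), pairSum_eq_zero hx (by omega), mul_zero]

theorem sum_kerVec_mul_prodEntry {x : ℂ} (hx : ∀ n : ℕ, x + n ≠ 0) {K b : ℕ} (hb : b ≤ 2 * K) :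
    ∑ a ∈ Finset.range (2 * K + 1), kerVec x K a * prodEntry x a b = 0 := by
  trans ∑ a ∈ Finset.range (2 * K + 1), ∑ k ∈ Finset.range (2 * K + 1),
    kerVec x K a * (signedChoose a k * skewForm x k b)
  · refine Finset.sum_congr rfl fun a ha => ?_
    rw [prodEntry_eq_sum x (Finset.mem_range.mp ha), Finset.mul_sum]
  · rw [Finset.sum_comm]
    trans ∑ k ∈ Finset.range (2 * K + 1), -(skewForm x b k * kerVec x K k)
    · refine Finset.sum_congr rfl fun k _ => ?_
      rw [← sum_choose_mul_kerVec x k (show 2 * K < 2 * K + 1 by omega), skewForm_swap x b k,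
        Finset.mul_sum, ← Finset.sum_neg_distrib]
      exact Finset.sum_congr rfl fun a _ => by rw [signedChoose]; ring
    · rw [Finset.sum_neg_distrib, sum_skewForm_mul_kerVec hx b (by omega),
        pairSum_eq_zero hx hb, neg_zero]

theorem of_prodEntry_eq_mul (x : ℂ) (N : ℕ) :
    (Matrix.of fun i j : Fin N => prodEntry x i j)
      = (Matrix.of fun i j : Fin N => signedChoose i j)
        * Matrix.of fun i j : Fin N => skewForm x i j := by
  ext i j
  rw [Matrix.of_apply, prodEntry_eq_sum x i.2, Finset.sum_range, Matrix.mul_apply]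
  rfl

theorem signedChoose_mul_self (N : ℕ) :
    (Matrix.of fun i j : Fin N => signedChoose i j) * (Matrix.of fun i j : Fin N => signedChoose i j)
      = 1 := by
  ext i j
  have := sum_signedChoose_mul i.2 j
  rw [Finset.sum_range] at this
  simp only [Matrix.mul_apply, Matrix.of_apply, this, Matrix.one_apply, Fin.ext_iff]

theorem det_signedChoose (K : ℕ) :
    (Matrix.of fun i j : Fin (2 * K) => signedChoose i j).det = (-1) ^ K := by
  rw [Matrix.det_of_isLowerTriangular]
  · simp only [Matrix.of_apply, signedChoose, Nat.choose_self, Nat.cast_one, mul_one]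
    rw [← Finset.prod_range (fun i => (-1 : ℂ) ^ i)]
    induction K with
    | zero => simp
    | succ K ih =>
      rw [show 2 * (K + 1) = 2 * K + 1 + 1 by ring, Finset.prod_range_succ, Finset.prod_range_succ, ih]
      simp [pow_succ, pow_mul]
  · intro i j hij
    have hij : (i : ℕ) < j := hij
    simp [signedChoose, Nat.choose_eq_zero_of_lt hij]

theorem det_prodEntry_two_mul {x : ℂ} (hx : ∀ n : ℕ, x + n ≠ 0) (K : ℕ) :
    (Matrix.of fun i j : Fin (2 * K) => prodEntry x i j).det
      = (-1) ^ K * ∏ k ∈ Finset.range K, (pairSum x k (2 * k + 1) / kerCoeff x k k) ^ 2 := by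
  rw [of_prodEntry_eq_mul, Matrix.det_mul, det_signedChoose, det_skewForm hx]

theorem kerVec_fin_ne_zero (x : ℂ) (K : ℕ) : (fun b : Fin (2 * K + 1) => kerVec x K b) ≠ 0 := by
  intro h
  have := congrFun h 0
  simp [kerVec_zero] at this

theorem mulVec_kerVec {x : ℂ} (hx : ∀ n : ℕ, x + n ≠ 0) (K : ℕ) :
    (Matrix.of fun i j : Fin (2 * K + 1) => prodEntry x i j).mulVec (fun b => kerVec x K b) = 0 := by
  ext a
  have := sum_prodEntry_mul_kerVec hx (show (a : ℕ) ≤ 2 * K by omega)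
  rwa [Finset.sum_range] at this

theorem vecMul_kerVec {x : ℂ} (hx : ∀ n : ℕ, x + n ≠ 0) (K : ℕ) :
    Matrix.vecMul (fun b : Fin (2 * K + 1) => kerVec x K b)
      (Matrix.of fun i j : Fin (2 * K + 1) => prodEntry x i j)
      = 0 := by
  ext a
  have := sum_kerVec_mul_prodEntry hx (show (a : ℕ) ≤ 2 * K by omega)
  rwa [Finset.sum_range] at this

theorem det_prodEntry_shift_one {x : ℂ} (hx : ∀ n : ℕ, x + n ≠ 0) (K : ℕ) :
    (Matrix.of fun i j : Fin (2 * K) => prodEntry x (i + 1) (j + 1)).det * kerCoeff x K K ^ 2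
      = (Matrix.of fun i j : Fin (2 * K) => prodEntry x i j).det := by
  set A := Matrix.of fun i j : Fin (2 * K + 1) => prodEntry x i j with hA
  have h1 := adjugate_mul_of_mulVec_eq_zero A _ (mulVec_kerVec hx K) (kerVec_fin_ne_zero x K)
    0 0 (Fin.last _)
  have h2 := adjugate_mul_of_vecMul_eq_zero A _ (vecMul_kerVec hx K) (kerVec_fin_ne_zero x K)
    (Fin.last _) 0 (Fin.last _)
  simp only [Fin.val_last, Fin.val_zero, kerVec_zero, kerVec_two_mul, one_mul] at h1 h2
  have e1 : A.adjugate 0 0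
      = (Matrix.of fun i j : Fin (2 * K) => prodEntry x (i + 1) (j + 1)).det := by
    rw [Matrix.adjugate_fin_succ_eq_det_submatrix]
    simp
    rfl
  have e2 : A.adjugate (Fin.last _) (Fin.last _)
      = (Matrix.of fun i j : Fin (2 * K) => prodEntry x i j).det := by
    rw [Matrix.adjugate_fin_succ_eq_det_submatrix]
    simp [← two_mul]
    rfl
  rw [← e1, ← e2]
  linear_combination kerCoeff x K K * h1 + h2

theorem det_prodEntry_shift_one_ne_zero {x : ℂ} (hx : ∀ n : ℕ, x + n ≠ 0) (K : ℕ) :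
    (Matrix.of fun i j : Fin (2 * K) => prodEntry x (i + 1) (j + 1)).det ≠ 0 := by
  intro h
  have h1 := det_prodEntry_shift_one hx K
  rw [h, zero_mul, det_prodEntry_two_mul hx] at h1
  refine mul_ne_zero (by simp) (Finset.prod_ne_zero_iff.mpr fun k _ => ?_) h1.symm
  exact pow_ne_zero 2 (div_ne_zero (pairSum_two_mul_add_one_ne_zero hx k)
    (kerCoeff_self_ne_zero hx k))

theorem skewForm_zero_left (x : ℂ) (b : ℕ) : skewForm x 0 (b + 1) = 1 := by
  simp [skewForm, wt, poch_zero]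

theorem skewForm_one_left {x : ℂ} (hx : ∀ n : ℕ, x + n ≠ 0) (b : ℕ) :
    (x + 1) * skewForm x 1 (b + 1) = -(b + 1) + if b = 0 then 1 else 0 := by
  have h1 : x + 1 ≠ 0 := by simpa using add_one_ne hx 0
  have h2 : wt x 1 = 1 / (x + 1) := by simp [wt, poch]
  cases b with
  | zero => simp [skewForm]
  | succ b =>
    simp [skewForm, h2, Nat.choose_eq_zero_of_lt (show 1 < b + 1 + 1 by omega)]
    field_simp

theorem det_prodEntry_shift_two {x : ℂ} (hx : ∀ n : ℕ, x + n ≠ 0) (m : ℕ) :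
    (Matrix.of fun i j : Fin (2 * m + 1) => prodEntry x (i + 2) (j + 2)).det
      = -((x + 1) * (x + 5) / 4)
        * (Matrix.of fun i j : Fin (2 * (m + 1)) => prodEntry x (i + 1) (j + 1)).det := by
  have hD := det_prodEntry_shift_one_ne_zero hx (m + 1)
  set B : Matrix (Fin (2 * m + 2)) (Fin (2 * m + 2)) ℂ :=
    Matrix.of fun i j => prodEntry x (i + 1) (j + 1) with hB
  have hD : B.det ≠ 0 := hD
  change _ = _ * B.det
  set D := B.det with hDdef
  set A : Matrix (Fin (2 * m + 3)) (Fin (2 * m + 3)) ℂ := Matrix.of fun i j => prodEntry x i j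
    with hA
  set P : Matrix (Fin (2 * m + 3)) (Fin (2 * m + 3)) ℂ := Matrix.of fun i j => signedChoose i j
    with hP
  set S : Matrix (Fin (2 * m + 3)) (Fin (2 * m + 3)) ℂ := Matrix.of fun i j => skewForm x i j
    with hS
  have hPP : P * P = 1 := signedChoose_mul_self _
  have hAPS : A = P * S := of_prodEntry_eq_mul x _
  have hST : S.transpose = -S := by
    ext i j
    simp only [Matrix.transpose_apply, hS, Matrix.of_apply, Matrix.neg_apply]
    exact skewForm_swap x _ _
  let u : Fin (2 * m + 3) → ℂ := Fin.cons 0 fun b => B.adjugate b 0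
  set φ := A.mulVec u with hφ
  set v := Matrix.vecMul u P with hv
  have hφs : ∀ i, φ (Fin.succ i) = if i = 0 then D else 0 := by
    intro i
    have h : (B * B.adjugate) i 0 = D * (1 : Matrix (Fin (2 * m + 2)) (Fin (2 * m + 2)) ℂ) i 0 := by
      rw [Matrix.mul_adjugate]
      rfl
    rw [Matrix.one_apply, mul_ite, mul_one, mul_zero] at h
    rw [← h, hφ, Matrix.mulVec, dotProduct, Fin.sum_univ_succ, Matrix.mul_apply]
    simp [u, hA, hB]
  have hdot : ∀ w : Fin (2 * m + 3) → ℂ, w ⬝ᵥ φ = w 0 * φ 0 + w 1 * D := by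
    intro w
    rw [dotProduct, Fin.sum_univ_succ]
    simp [hφs]
  have hu1 : u 1 = (Matrix.of fun i j : Fin (2 * m + 1) => prodEntry x (i + 2) (j + 2)).det := by
    change B.adjugate 0 0 = _
    rw [Matrix.adjugate_fin_succ_eq_det_submatrix]
    simp
    rfl
  have hφ0 : φ 0 + (x + 1) / 2 * D = 0 := by
    have h := hdot (fun b => kerVec x (m + 1) b)
    rw [hφ, Matrix.dotProduct_mulVec] at h
    have h0 : Matrix.vecMul (fun b : Fin (2 * m + 3) => kerVec x (m + 1) b) A = 0 :=
      vecMul_kerVec hx (m + 1)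
    rw [h0, zero_dotProduct] at h
    simp only [Fin.val_zero, kerVec_zero, one_mul, Fin.val_one, kerVec_one hx] at h
    exact h.symm
  have hSu : S.mulVec u = P.mulVec φ := by
    rw [hφ, Matrix.mulVec_mulVec, hAPS, ← Matrix.mul_assoc, hPP, Matrix.one_mul]
  have hSu0 : v 0 = φ 0 := by
    have h := congrFun hSu 0
    have h1 : P.mulVec φ 0 = φ 0 := by
      rw [Matrix.mulVec, hdot]
      simp [hP, signedChoose]
    have h2 : v 0 = ∑ b, B.adjugate b 0 := by
      rw [hv, Matrix.vecMul, dotProduct, Fin.sum_univ_succ]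
      simp [u, hP, signedChoose]
    have h3 : S.mulVec u 0 = ∑ b, B.adjugate b 0 := by
      rw [Matrix.mulVec, dotProduct, Fin.sum_univ_succ]
      simp [u, hS, skewForm_zero_left]
    rw [← h1, ← h, h2, h3]
  have hSu1 : v 1 + u 1 = (x + 1) * (φ 0 - D) := by
    have h := congrFun hSu 1
    have h1 : P.mulVec φ 1 = φ 0 - D := by
      rw [Matrix.mulVec, hdot]
      simp [hP, signedChoose]
      ring
    have h2 : v 1 = ∑ b : Fin (2 * m + 2), -(b + 1 : ℂ) * B.adjugate b 0 := by
      rw [hv, Matrix.vecMul, dotProduct, Fin.sum_univ_succ]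
      simp [u, hP, signedChoose, mul_comm]
    have h3 : (x + 1) * S.mulVec u 1
        = ∑ b : Fin (2 * m + 2), (-(b + 1 : ℂ) + if (b : ℕ) = 0 then 1 else 0) * B.adjugate b 0 := by
      rw [Matrix.mulVec, dotProduct, Fin.sum_univ_succ, mul_add, Finset.mul_sum]
      simp only [hS, Matrix.of_apply, Fin.val_one, Fin.val_succ, ← mul_assoc,
        skewForm_one_left hx]
      simp [u]
    have h4 : u 1 = ∑ b : Fin (2 * m + 2), (if (b : ℕ) = 0 then 1 else 0) * B.adjugate b 0 := by
      have h5 : u 1 = B.adjugate 0 0 := rfl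
      rw [h5, Fin.sum_univ_succ]
      simp
    rw [← h1, ← h, h3, h2, h4, ← Finset.sum_add_distrib]
    exact Finset.sum_congr rfl fun b _ => by ring
  have hvφ : v 0 * φ 0 + v 1 * D = 0 := by
    rw [← hdot, hv, hφ, hAPS, Matrix.dotProduct_mulVec, Matrix.vecMul_vecMul, ← Matrix.mul_assoc,
      hPP, Matrix.one_mul]
    have h : Matrix.vecMul u S ⬝ᵥ u = -(Matrix.vecMul u S ⬝ᵥ u) := by
      conv_lhs => rw [← Matrix.mulVec_transpose, hST, Matrix.neg_mulVec, neg_dotProduct,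
        dotProduct_comm, Matrix.dotProduct_mulVec]
    exact self_eq_neg.mp h
  rw [← hu1]
  refine mul_left_cancel₀ hD ?_
  have hφ0' : φ 0 = -((x + 1) / 2 * D) := by linear_combination hφ0
  rw [hSu0, hφ0'] at hvφ
  rw [hφ0'] at hSu1
  linear_combination D * hSu1 - hvφ

/-- The first Pochhammer product in the closed form of the determinant. -/
noncomputable def risingProd (x : ℂ) (m : ℕ) : ℂ :=
  ∏ i ∈ Finset.range ((m + 2) / 2), poch ((x + 7 + 6 * i) / 2) (m - 2 * i)

/-- The second Pochhammer product in the closed form of the determinant. -/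
noncomputable def fallingProd (x : ℂ) (m : ℕ) : ℂ :=
  ∏ i ∈ Finset.range ((m + 1) / 2), poch ((-x - 6 * m - 2 + 6 * i) / 2) (m - 1 - 2 * i)

theorem risingProd_succ (x : ℂ) (m : ℕ) :
    risingProd x (m + 1)
      = risingProd x m * ∏ i ∈ Finset.range (m / 2 + 1), ((x + 2 * m + 7 + 2 * i) / 2) := by
  have h1 : risingProd x (m + 1)
      = ∏ i ∈ Finset.range (m / 2 + 1), poch ((x + 7 + 6 * i) / 2) (m + 1 - 2 * i) := by
    symm
    refine Finset.prod_subset (Finset.range_mono (by omega)) fun i hi hi' => ?_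
    simp only [Finset.mem_range] at hi hi'
    rw [show m + 1 - 2 * i = 0 by omega, poch_zero]
  rw [h1, risingProd, show (m + 2) / 2 = m / 2 + 1 by omega, ← Finset.prod_mul_distrib]
  refine Finset.prod_congr rfl fun i hi => ?_
  have hi := Finset.mem_range.mp hi
  rw [show m + 1 - 2 * i = m - 2 * i + 1 by omega, poch_succ,
    Nat.cast_sub (by omega : 2 * i ≤ m)]
  push_cast
  ring

theorem fallingProd_succ (x : ℂ) (m : ℕ) :
    fallingProd x (m + 1) * ∏ i ∈ Finset.range (m / 2), ((-x - 4 * m - 6 + 2 * i) / 2)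
      = fallingProd x m * poch ((-x - 6 * m - 8) / 2) m := by
  have h1 : fallingProd x m
      = ∏ i ∈ Finset.range (m / 2), poch ((-x - 6 * m - 2 + 6 * i) / 2) (m - 1 - 2 * i) := by
    symm
    refine Finset.prod_subset (Finset.range_mono (by omega)) fun i hi hi' => ?_
    simp only [Finset.mem_range] at hi hi'
    rw [show m - 1 - 2 * i = 0 by omega, poch_zero]
  rw [h1, fallingProd, show (m + 1 + 1) / 2 = m / 2 + 1 by omega, Finset.prod_range_succ',
    mul_right_comm, ← Finset.prod_mul_distrib]
  congr 1
  · refine Finset.prod_congr rfl fun i hi => ?_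
    have hi := Finset.mem_range.mp hi
    rw [show m - 1 - 2 * i = m - 2 - 2 * i + 1 by omega, poch_succ,
      show m + 1 - 1 - 2 * (i + 1) = m - 2 - 2 * i by omega, Nat.sub_sub,
      Nat.cast_sub (by omega : 2 + 2 * i ≤ m)]
    push_cast
    ring_nf
  · push_cast
    ring_nf
    simp

theorem prod_range_two_mul (f : ℕ → ℂ) (t : ℕ) :
    ∏ i ∈ Finset.range (2 * t), f i
      = (∏ i ∈ Finset.range t, f (2 * i)) * ∏ i ∈ Finset.range t, f (2 * i + 1) := by
  induction t with
  | zero => simp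
  | succ t ih =>
    rw [show 2 * (t + 1) = 2 * t + 1 + 1 by ring, Finset.prod_range_succ, Finset.prod_range_succ, ih,
      Finset.prod_range_succ, Finset.prod_range_succ]
    ring

theorem prod_add_mul_prod_sub (y : ℂ) (m : ℕ) :
    (∏ i ∈ Finset.range (m + 2), (y + i)) * ∏ i ∈ Finset.range (m / 2), (y + 2 * m - 2 * i)
      = (∏ i ∈ Finset.range (m / 2 + 1), (y + 1 + 2 * i))
        * ∏ i ∈ Finset.range (m + 1), (y + 2 * i) := by
  have key : ∀ r s : ℕ, ∏ i ∈ Finset.range (r + s), (y + 2 * i)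
      = (∏ i ∈ Finset.range r, (y + 2 * i))
        * ∏ i ∈ Finset.range s, (y + 2 * (r + s - 1 : ℂ) - 2 * i) := by
    intro r s
    rw [Finset.prod_range_add]
    congr 1
    rw [← Finset.prod_range_reflect]
    refine Finset.prod_congr rfl fun i hi => ?_
    have hi := Finset.mem_range.mp hi
    rw [show s - 1 - i = s - (1 + i) by omega]
    push_cast [Nat.cast_sub (show 1 + i ≤ s by omega)]
    ring
  obtain ⟨s, rfl | rfl⟩ := m.even_or_odd'
  · rw [show 2 * s / 2 = s by omega, show 2 * s + 2 = 2 * (s + 1) by ring, prod_range_two_mul,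
      show 2 * s + 1 = (s + 1) + s by ring, key]
    push_cast
    ring_nf
  · rw [show (2 * s + 1) / 2 = s by omega, show 2 * s + 1 + 2 = 2 * (s + 1) + 1 by ring,
      Finset.prod_range_succ, prod_range_two_mul,
      show 2 * s + 1 + 1 = (s + 2) + s by ring, key, Finset.prod_range_succ _ (s + 1)]
    push_cast
    ring_nf

theorem prod_range_div_two (f : ℕ → ℂ) (n : ℕ) :
    ∏ i ∈ Finset.range n, f i / 2 = (∏ i ∈ Finset.range n, f i) / 2 ^ n := by
  rw [Finset.prod_div_distrib, Finset.prod_const, Finset.card_range]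

theorem closed_form_ratio {x : ℂ} (hx : ∀ n : ℕ, x + n ≠ 0) (m : ℕ) :
    2 ^ (m + 2) * ((m + 1).factorial / (2 * (m + 1)).factorial) * risingProd x (m + 1)
        * fallingProd x (m + 1) * kerCoeff x (m + 2) (m + 2) * wt x (2 * m + 3)
      = (-1) ^ m * (-1) ^ (m / 2) * risingProd x m * fallingProd x m
        * pairSum x (m + 1) (2 * m + 3) := by
  have hP1 := risingProd_succ x m
  have hP2 := fallingProd_succ x m
  have core := prod_add_mul_prod_sub (x + 2 * m + 6) m
  have hL := kerCoeff_self hx (m + 2)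
  have hh := pairSum_two_mul_add_one hx (m + 1)
  have hw : wt x (2 * m + 3) = (2 * m + 3).factorial / poch (x + 1) (2 * m + 3) := rfl
  have hpoch : poch (x + 1) (2 * m + 3) = (∏ i ∈ Finset.range (m + 2), (x + 2 * i + 1))
      * ∏ i ∈ Finset.range (m + 1), (x + 2 + 2 * i) := by
    rw [poch, show 2 * m + 3 = 2 * (m + 1) + 1 by ring, Finset.prod_range_succ, prod_range_two_mul,
      Finset.prod_range_succ _ (m + 1), mul_right_comm]
    push_cast
    ring_nf
  have hU : ∏ i ∈ Finset.range (m / 2 + 1), ((x + 2 * m + 7 + 2 * i) / 2)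
      = (∏ i ∈ Finset.range (m / 2 + 1), (x + 2 * m + 6 + 1 + 2 * i)) / 2 ^ (m / 2 + 1) := by
    rw [prod_range_div_two]
    ring_nf
  have hV : ∏ i ∈ Finset.range (m / 2), ((-x - 4 * m - 6 + 2 * i) / 2)
      = (-1) ^ (m / 2) * (∏ i ∈ Finset.range (m / 2), (x + 2 * m + 6 + 2 * m - 2 * i))
        / 2 ^ (m / 2) := by
    have h : (-1 : ℂ) ^ (m / 2) = ∏ _i ∈ Finset.range (m / 2), (-1 : ℂ) := by simp
    rw [prod_range_div_two, h, ← Finset.prod_mul_distrib]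
    congr 1
    exact Finset.prod_congr rfl fun i _ => by ring
  have hW : poch ((-x - 6 * m - 8) / 2) m
      = (-1) ^ m * (∏ i ∈ Finset.range m, (x + 4 * m + 10 + 2 * i)) / 2 ^ m := by
    rw [show (-x - 6 * m - 8) / 2 = 1 - (x + 4 * m + 10) / 2 - m by ring, poch_reflect, poch,
      mul_div_assoc, ← prod_range_div_two]
    congr 1
    exact Finset.prod_congr rfl fun i _ => by ring
  have hc2 : ∏ i ∈ Finset.range (m + 2), (x + 2 * (m + 2 : ℕ) + 2 + 2 * i)
      = (∏ i ∈ Finset.range (m + 1), (x + 2 * m + 6 + 2 * i)) * (x + 4 * m + 8) := by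
    rw [Finset.prod_range_succ]
    push_cast
    ring_nf
  have hc1 : ∏ i ∈ Finset.range (m + 2), (x + 2 * (m + 2 : ℕ) + 2 + i)
      = ∏ i ∈ Finset.range (m + 2), (x + 2 * m + 6 + i) := by
    push_cast
    ring_nf
  have ha3 : ∏ i ∈ Finset.range (m + 1), (x + 4 * (m + 1 : ℕ) + 4 + 2 * i)
      = (∏ i ∈ Finset.range m, (x + 4 * m + 10 + 2 * i)) * (x + 4 * m + 8) := by
    rw [Finset.prod_range_succ']
    push_cast
    ring_nf
  have nV : ∏ i ∈ Finset.range (m / 2), (x + 2 * m + 6 + 2 * m - 2 * i) ≠ 0 := by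
    refine Finset.prod_ne_zero_iff.mpr fun i hi => ?_
    have hi := Finset.mem_range.mp hi
    have h := hx (4 * m + 6 - 2 * i)
    rw [Nat.cast_sub (by omega)] at h
    push_cast at h
    convert h using 1
    ring
  have nc1 : ∏ i ∈ Finset.range (m + 2), (x + 2 * m + 6 + i) ≠ 0 := by
    refine Finset.prod_ne_zero_iff.mpr fun i hi => ?_
    have h := hx (2 * m + 6 + i)
    push_cast at h
    convert h using 1
    ring
  have nb1 : ∏ i ∈ Finset.range (m + 2), (x + 2 * i + 1) ≠ 0 := by
    refine Finset.prod_ne_zero_iff.mpr fun i hi => ?_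
    have h := hx (2 * i + 1)
    push_cast at h
    convert h using 1
    ring
  have nb2 : ∏ i ∈ Finset.range (m + 1), (x + 2 + 2 * i) ≠ 0 := by
    refine Finset.prod_ne_zero_iff.mpr fun i hi => ?_
    have h := hx (2 + 2 * i)
    push_cast at h
    convert h using 1
    ring
  rw [Finset.prod_div_distrib, Finset.prod_mul_distrib, hc1, hc2] at hL
  rw [Finset.prod_div_distrib, ha3] at hh
  rw [hpoch] at hw
  rw [hU] at hP1
  rw [hV, hW] at hP2
  rw [show 2 * (m + 1) + 1 = 2 * m + 3 by ring] at hh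
  rw [hP1, hL, hw, hh]
  generalize (∏ i ∈ Finset.range (m / 2), (x + 2 * m + 6 + 2 * m - 2 * i)) = a2 at *
  generalize (∏ i ∈ Finset.range (m / 2 + 1), (x + 2 * m + 6 + 1 + 2 * i)) = a1 at *
  generalize (∏ i ∈ Finset.range (m + 2), (x + 2 * m + 6 + i)) = c1 at *
  generalize (∏ i ∈ Finset.range (m + 1), (x + 2 * m + 6 + 2 * i)) = c2 at *
  generalize (∏ i ∈ Finset.range (m + 2), (x + 2 * i + 1)) = b1 at *
  generalize (∏ i ∈ Finset.range (m + 1), (x + 2 + 2 * i)) = b2 at *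
  generalize (∏ i ∈ Finset.range m, (x + 4 * m + 10 + 2 * i)) = a3 at *
  have he : ((-1 : ℂ) ^ (m / 2)) ^ 2 = 1 := by rw [← pow_mul, pow_mul']; simp
  have hP2' : fallingProd x (m + 1) = fallingProd x m * ((-1) ^ m * a3 / 2 ^ m)
      * ((-1) ^ (m / 2) * 2 ^ (m / 2) / a2) := by
    rw [← hP2]
    field_simp
    rw [he]; ring
  have nc2 : c2 ≠ 0 := by
    rintro rfl
    simp [nc1, nV] at core
  have core' : a1 = c1 * a2 / c2 := by
    rw [eq_div_iff nc2]
    exact core.symm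
  have nf1 : ((m + 1).factorial : ℂ) ≠ 0 := Nat.cast_ne_zero.mpr (Nat.factorial_ne_zero _)
  have nf2 : ((2 * (m + 1)).factorial : ℂ) ≠ 0 := Nat.cast_ne_zero.mpr (Nat.factorial_ne_zero _)
  have nf3 : ((2 * m + 3).factorial : ℂ) ≠ 0 := Nat.cast_ne_zero.mpr (Nat.factorial_ne_zero _)
  have nm : (m : ℂ) + 2 ≠ 0 := by exact_mod_cast Nat.succ_ne_zero (m + 1)
  rw [hP2', core', show 2 * (m + 2) = 2 * m + 3 + 1 by ring, Nat.factorial_succ (2 * m + 3),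
    show m + 2 = m + 1 + 1 by ring, Nat.factorial_succ (m + 1)]
  generalize (m + 1).factorial = F1 at *
  generalize (2 * (m + 1)).factorial = F2 at *
  generalize (2 * m + 3).factorial = F3 at *
  push_cast
  rw [show 2 * (m : ℂ) + 3 + 1 = 2 * (m + 2) by ring, show (m : ℂ) + 1 + 1 = m + 2 by ring]
  field_simp
  ring

/-- The asserted value of the determinant of size `2 * m + 1` at `μ = x + 4`. -/
noncomputable def closedForm (x : ℂ) (m : ℕ) : ℂ :=
  (-1) ^ m * 2 ^ (m * (m + 3)) * (x + 5) * poch ((x + 2) / 2) (m + 1) / ((m + 1).factorial : ℂ)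
    * (∏ i ∈ Finset.range (m + 1), ((i.factorial : ℂ) ^ 2 / ((2 * i).factorial : ℂ) ^ 2))
    * risingProd x m ^ 2 * fallingProd x m ^ 2

theorem closedForm_succ {x : ℂ} (hx : ∀ n : ℕ, x + n ≠ 0) (m : ℕ) :
    wt x (2 * m + 3) * wt x (2 * m + 4) * closedForm x (m + 1) * kerCoeff x (m + 2) (m + 2) ^ 2
      = -(closedForm x m * pairSum x (m + 1) (2 * m + 3) ^ 2) := by
  have hr := closed_form_ratio hx m
  have hs : ((-1 : ℂ) ^ m * (-1) ^ (m / 2)) ^ 2 = 1 := by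
    rw [mul_pow, ← pow_mul, ← pow_mul, pow_mul', pow_mul']
    simp
  have hr2 := congrArg (· ^ 2) hr
  simp only [mul_pow _ (pairSum _ _ _), mul_pow _ (fallingProd _ _), mul_pow _ (risingProd _ _),
    hs, one_mul] at hr2
  have hw : wt x (2 * m + 4) = wt x (2 * m + 3) * (2 * (m + 2)) / (x + 2 * m + 4) := by
    have h := wt_succ hx (2 * m + 3)
    have h4 := hx (2 * m + 4)
    push_cast at h h4
    rw [eq_div_iff (by rwa [add_assoc])]
    linear_combination h
  have n4 : x + 2 * m + 4 ≠ 0 := by simpa using add_two_mul_ne hx m 4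
  have nf1 : ((m + 1).factorial : ℂ) ≠ 0 := Nat.cast_ne_zero.mpr (Nat.factorial_ne_zero _)
  have nm : (m : ℂ) + 2 ≠ 0 := by exact_mod_cast Nat.succ_ne_zero (m + 1)
  set A : ℂ := (-1) ^ m * 2 ^ (m * (m + 3)) * (x + 5) * poch ((x + 2) / 2) (m + 1)
    / ((m + 1).factorial : ℂ)
    * ∏ i ∈ Finset.range (m + 1), ((i.factorial : ℂ) ^ 2 / ((2 * i).factorial : ℂ) ^ 2) with hA
  have h0 : closedForm x m = A * risingProd x m ^ 2 * fallingProd x m ^ 2 := rfl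
  have h1 : closedForm x (m + 1) = -(A * (2 ^ (m + 2)) ^ 2 * ((x + 2 * m + 4) / (2 * (m + 2)))
      * ((m + 1).factorial / (2 * (m + 1)).factorial) ^ 2
      * risingProd x (m + 1) ^ 2 * fallingProd x (m + 1) ^ 2) := by
    rw [closedForm, hA, Finset.prod_range_succ _ (m + 1), poch_succ _ (m + 1),
      Nat.factorial_succ (m + 1), show (m + 1) * (m + 1 + 3) = m * (m + 3) + (m + 2) * 2 by ring,
      pow_add 2 (m * (m + 3)), pow_mul 2 (m + 2), pow_succ (-1 : ℂ) m]
    push_cast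
    rw [show (m : ℂ) + 1 + 1 = m + 2 by ring]
    field_simp
    ring
  rw [h0, h1, hw]
  field_simp
  linear_combination (-A) * hr2

theorem closedForm_mul {x : ℂ} (hx : ∀ n : ℕ, x + n ≠ 0) (m : ℕ) :
    (∏ j ∈ Finset.range (2 * m + 1), wt x (j + 2)) * closedForm x m
        * kerCoeff x (m + 1) (m + 1) ^ 2
      = -((x + 1) * (x + 5) / 4) * ((-1) ^ (m + 1)
        * ∏ k ∈ Finset.range (m + 1), (pairSum x k (2 * k + 1) / kerCoeff x k k) ^ 2) := by
  induction m with
  | zero =>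
    have h1 : x + 1 ≠ 0 := by simpa using hx 1
    have h2 : x + 2 ≠ 0 := by simpa using hx 2
    have h4 : x + 4 ≠ 0 := by simpa using hx 4
    simp [closedForm, wt, kerCoeff_self hx, pairSum_two_mul_add_one hx 0, poch, risingProd,
      fallingProd, Finset.prod_range_succ]
    rw [show x + 1 + 1 = x + 2 by ring, show x + 2 + 2 = x + 4 by ring]
    field_simp
    ring
  | succ m ih =>
    have hL := kerCoeff_self_ne_zero hx (m + 1)
    have hr := closedForm_succ hx m
    rw [Finset.prod_range_succ _ (m + 1), show 2 * (m + 1) + 1 = 2 * m + 1 + 1 + 1 by ring,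
      Finset.prod_range_succ, Finset.prod_range_succ, pow_succ _ (m + 1)]
    calc _ = (∏ j ∈ Finset.range (2 * m + 1), wt x (j + 2)) * (wt x (2 * m + 3) * wt x (2 * m + 4)
          * closedForm x (m + 1) * kerCoeff x (m + 2) (m + 2) ^ 2) := by ring_nf
      _ = -((∏ j ∈ Finset.range (2 * m + 1), wt x (j + 2)) * closedForm x m
          * kerCoeff x (m + 1) (m + 1) ^ 2)
          * (pairSum x (m + 1) (2 * m + 3) / kerCoeff x (m + 1) (m + 1)) ^ 2 := by
        rw [hr]
        field_simp
      _ = _ := by rw [ih, show 2 * m + 1 + 1 + 1 = 2 * m + 3 by ring]; ring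

theorem det_eq_closedForm {x : ℂ} (hx : ∀ n : ℕ, x + n ≠ 0) (m : ℕ) :
    Matrix.det (Matrix.of fun i j : Fin (2 * m + 1) =>
      (if i = j then (-1 : ℂ) else 0)
        + gbinom (x + 4 + ((i.1 : ℂ) + 1) + ((j.1 : ℂ) + 1) - 2) (j.1 + 1 + 1)) = closedForm x m := by
  have hW : ∏ j ∈ Finset.range (2 * m + 1), wt x (j + 2) ≠ 0 :=
    Finset.prod_ne_zero_iff.mpr fun j _ => wt_ne_zero hx _
  have hL := pow_ne_zero 2 (kerCoeff_self_ne_zero hx (m + 1))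
  refine mul_left_cancel₀ hW (mul_right_cancel₀ hL ?_)
  rw [closedForm_mul hx, ← det_prodEntry_two_mul hx, ← det_prodEntry_shift_one hx, ← mul_assoc,
    ← det_prodEntry_shift_two hx, Finset.prod_range, ← Matrix.det_mul_row]
  congr 2
  ext i j
  rw [Matrix.of_apply, Matrix.of_apply, Matrix.of_apply, prodEntry_eq hx]
  congr 2
  · simp [Fin.ext_iff]
  · push_cast
    ring_nf

theorem continuous_poch (k : ℕ) : Continuous fun z => poch z k := by
  unfold poch
  fun_prop

theorem continuous_gbinom (k : ℕ) : Continuous fun z => gbinom z k := by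
  unfold gbinom
  fun_prop

theorem continuous_closedForm (m : ℕ) : Continuous fun x => closedForm x m := by
  have h := continuous_poch
  have h1 : Continuous fun x => risingProd x m :=
    continuous_finsetProd _ fun i _ => (h _).comp (by fun_prop)
  have h2 : Continuous fun x => fallingProd x m :=
    continuous_finsetProd _ fun i _ => (h _).comp (by fun_prop)
  have h3 : Continuous fun x : ℂ => poch ((x + 2) / 2) (m + 1) := (h _).comp (by fun_prop)
  unfold closedForm
  fun_prop

theorem det_eq_closedForm_of_all (x : ℂ) (m : ℕ) :
    Matrix.det (Matrix.of fun i j : Fin (2 * m + 1) =>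
      (if i = j then (-1 : ℂ) else 0)
        + gbinom (x + 4 + ((i.1 : ℂ) + 1) + ((j.1 : ℂ) + 1) - 2) (j.1 + 1 + 1)) = closedForm x m := by
  have hs : Dense (Set.range fun n : ℕ => -(n : ℂ))ᶜ :=
    (Set.countable_range _).dense_compl ℂ
  refine congrFun (Continuous.ext_on hs ?_ (continuous_closedForm m) fun y hy =>
    det_eq_closedForm (fun n hn => hy ⟨n, (eq_neg_of_add_eq_zero_left hn).symm⟩) m) x
  refine Continuous.matrix_det (continuous_matrix fun i j => ?_)
  exact continuous_const.add ((continuous_gbinom _).comp (by fun_prop))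

theorem prod_Icc_one (f : ℕ → ℂ) (n : ℕ) :
    ∏ i ∈ Finset.Icc 1 n, f i = ∏ i ∈ Finset.range n, f (i + 1) := by
  rw [← Finset.Ico_succ_right_eq_Icc, Finset.prod_Ico_eq_prod_range]
  simp [add_comm]

/-- Krattenthaler's Conjecture 36 (Theorem 5): the determinant with entries
`-δ_{i,j} + C(μ+i+j-2, j+1)` for odd `n`. -/
theorem krattenthaler_conj36 (μ : ℂ) (n : ℕ) (hn : 0 < n) (hno : Odd n) :
    Matrix.det (Matrix.of fun i j : Fin n =>
      (if i = j then (-1 : ℂ) else 0)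
        + gbinom (μ + ((i.1 : ℂ) + 1) + ((j.1 : ℂ) + 1) - 2) (j.1 + 1 + 1))
    = (-1) ^ ((n - 1) / 2) * 2 ^ ((n - 1) * (n + 5) / 4) * (μ + 1)
        * poch ((μ - 2) / 2) ((n + 1) / 2) / (((n + 1) / 2).factorial : ℂ)
        * (∏ i ∈ Finset.range ((n - 1) / 2 + 1),
            ((i.factorial : ℂ) ^ 2 / ((2 * i).factorial : ℂ) ^ 2))
        * (∏ i ∈ Finset.Icc 1 ((n + 3) / 4),
            (poch ((μ + 6 * i - 3) / 2) ((n + 3 - 4 * i) / 2)) ^ 2)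
        * ∏ i ∈ Finset.Icc 1 ((n + 1) / 4),
            (poch ((-μ - 3 * n + 6 * i - 1) / 2) ((n + 1 - 4 * i) / 2)) ^ 2 := by
  obtain ⟨m, rfl⟩ := hno
  have h := det_eq_closedForm_of_all (μ - 4) m
  rw [sub_add_cancel] at h
  rw [h, closedForm, risingProd, fallingProd, prod_Icc_one, prod_Icc_one, Finset.prod_pow,
    Finset.prod_pow, show (2 * m + 1 - 1) / 2 = m by omega, show (2 * m + 1 + 1) / 2 = m + 1 by omega,
    show (2 * m + 1 - 1) * (2 * m + 1 + 5) / 4 = m * (m + 3) from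
      Nat.div_eq_of_eq_mul_left (by norm_num) (by rw [Nat.add_sub_cancel]; ring),
    show (2 * m + 1 + 3) / 4 = (m + 2) / 2 by omega, show (2 * m + 1 + 1) / 4 = (m + 1) / 2 by omega]
  have h1 : ∏ i ∈ Finset.range ((m + 2) / 2), poch ((μ - 4 + 7 + 6 * i) / 2) (m - 2 * i)
      = ∏ i ∈ Finset.range ((m + 2) / 2),
        poch ((μ + 6 * (i + 1 : ℕ) - 3) / 2) ((2 * m + 1 + 3 - 4 * (i + 1)) / 2) := by
    refine Finset.prod_congr rfl fun i _ => ?_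
    congr 1
    · push_cast
      ring
    · omega
  have h2 : ∏ i ∈ Finset.range ((m + 1) / 2),
        poch ((-(μ - 4) - 6 * m - 2 + 6 * i) / 2) (m - 1 - 2 * i)
      = ∏ i ∈ Finset.range ((m + 1) / 2),
        poch ((-μ - 3 * (2 * m + 1 : ℕ) + 6 * (i + 1 : ℕ) - 1) / 2)
          ((2 * m + 1 + 1 - 4 * (i + 1)) / 2) := by
    refine Finset.prod_congr rfl fun i _ => ?_
    congr 1
    · push_cast
      ring
    · omega
  rw [h1, h2, show μ - 4 + 5 = μ + 1 by ring, show μ - 4 + 2 = μ - 2 by ring]
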